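/- For every balayage π, the set P_MC^π(𝒮) is a compact convex subset of the space of finite signed Borel measures on 𝒮 with the weak-* topology, and it is a Choquet simplex. Moreover, μ ∈ P_MC^π(𝒮) is an extreme point of P_MC^π(𝒮) if and only if μ has trivial tail. -/

import Mathlib

open MeasureTheory Filter
open scoped ENNReal NNReal

namespace VMCPaper

abbrev Path : Type := ℕ → ℕ

def staircaseSet : Set Path :=
  {S | (∀ N, S N ≤ N) ∧ ∀ N, S (N + 1) = S N ∨ S (N + 1) = N + 1}

noncomputable def pr {α : Type*} [MeasurableSpace α] (μ : Measure α) (A : Set α) : ℝ :=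
  (μ A).toReal

def IsSMC (μ : Measure Path) : Prop :=
  IsProbabilityMeasure μ ∧ μ staircaseSet = 1 ∧
  ∀ (N : ℕ) (a : ℕ → ℕ),
    0 < pr μ {S | ∀ i ≤ N, S i = a i} →
    pr μ {S | (∀ i ≤ N, S i = a i) ∧ S (N + 1) = a (N + 1)} /
        pr μ {S | ∀ i ≤ N, S i = a i}
      = pr μ {S | S N = a N ∧ S (N + 1) = a (N + 1)} / pr μ {S | S N = a N}

noncomputable def marginals (μ : Measure Path) : ℕ → ℕ → ℝ :=
  fun N a => pr μ {S | S N = a}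

def D : Set (ℕ → ℕ → ℝ) :=
  {ν | (∀ N a, 0 ≤ ν N a) ∧ (∀ N a, N < a → ν N a = 0) ∧
       (∀ N, ∑ a ∈ Finset.range (N + 1), ν N a = 1) ∧
       ∀ N a, a ≤ N → ν (N + 1) a ≤ ν N a}

def PMC : Set (ProbabilityMeasure Path) := {μ | IsSMC (μ : Measure Path)}

def IsBalayage (π : ℕ → ℕ → ℝ) : Prop :=
  (∀ N a, 0 ≤ π N a) ∧ (∀ N a, N < a → π N a = 0) ∧
  ∀ N, ∑ a ∈ Finset.range (N + 1), π N a = 1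

def Dpi (π : ℕ → ℕ → ℝ) : Set (ℕ → ℕ → ℝ) :=
  {ν | ν ∈ D ∧ ∀ N a, a ≤ N → ν N a = ν (N + 1) a + ν (N + 1) (N + 1) * π N a}

def PMCpi (π : ℕ → ℕ → ℝ) : Set (Measure Path) :=
  {μ | IsSMC μ ∧ ∀ N a, a ≤ N →
    0 < pr μ {S | S (N + 1) = N + 1} →
    pr μ {S | S N = a ∧ S (N + 1) = N + 1} / pr μ {S | S (N + 1) = N + 1} = π N a}

def pathTail : MeasurableSpace Path :=
  ⨅ N : ℕ, MeasurableSpace.comap (fun (S : Path) (i : ℕ) => S (N + i)) inferInstance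

def HasTrivialTail (μ : Measure Path) : Prop :=
  ∀ A : Set Path, MeasurableSet[pathTail] A → μ A = 0 ∨ μ A = 1

def AffineOn {E : Type*} [AddCommMonoid E] [Module ℝ E] (f : E → ℝ) (K : Set E) : Prop :=
  ∀ x ∈ K, ∀ y ∈ K, ∀ t : ℝ, 0 ≤ t → t ≤ 1 →
    f (t • x + (1 - t) • y) = t * f x + (1 - t) * f y

def RepresentsOn {E : Type*} [AddCommMonoid E] [Module ℝ E] [TopologicalSpace E]
    [MeasurableSpace E] (m : Measure E) (K : Set E) (x : E) : Prop :=
  ∀ f : E → ℝ, ContinuousOn f K → AffineOn f K → f x = ∫ y, f y ∂m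

def IsChoquetSimplex {E : Type*} [AddCommMonoid E] [Module ℝ E] [TopologicalSpace E]
    [MeasurableSpace E] (K : Set E) : Prop :=
  ∀ x ∈ K, ∃! m : Measure E,
    IsProbabilityMeasure m ∧ m (Set.extremePoints ℝ K) = 1 ∧ RepresentsOn m K x

noncomputable def hitTime (x : Path) (A : Set ℕ) : ℕ → ℕ∞
  | 0 => ⨅ i ∈ {i : ℕ | x i ∈ A}, (i : ℕ∞)
  | k + 1 => ⨅ i ∈ {i : ℕ | hitTime x A k < (i : ℕ∞) ∧ x i ∈ A}, (i : ℕ∞)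

noncomputable def proj (N : ℕ) (x : Path) : Path := fun i =>
  if hitTime x {a | a ≤ N} i = ⊤ then 0 else x (hitTime x {a | a ≤ N} i).toNat

def pathSpace (N : ℕ) : Set Path :=
  {x | (∀ i, x i ≤ N) ∧ ∀ i, x i = 0 → ∀ j, i ≤ j → x j = 0}

def fullPathSpace : Set Path := {x | ∀ i, x i = 0 → ∀ j, i ≤ j → x j = 0}

def IsMarkovChain {Ω : Type*} [MeasurableSpace Ω] (P : Measure Ω) (Y : ℕ → Ω → ℕ) : Prop :=
  (∀ i, Measurable (Y i)) ∧
  (∀ (n : ℕ) (b : ℕ → ℕ),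
    0 < (P {ω | ∀ i ≤ n, Y i ω = b i}).toReal →
    (P {ω | (∀ i ≤ n, Y i ω = b i) ∧ Y (n + 1) ω = b (n + 1)}).toReal /
        (P {ω | ∀ i ≤ n, Y i ω = b i}).toReal
      = (P {ω | Y n ω = b n ∧ Y (n + 1) ω = b (n + 1)}).toReal /
        (P {ω | Y n ω = b n}).toReal) ∧
  (∀ m n b c : ℕ,
    0 < (P {ω | Y m ω = b}).toReal → 0 < (P {ω | Y n ω = b}).toReal →
    (P {ω | Y m ω = b ∧ Y (m + 1) ω = c}).toReal / (P {ω | Y m ω = b}).toReal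
      = (P {ω | Y n ω = b ∧ Y (n + 1) ω = c}).toReal / (P {ω | Y n ω = b}).toReal)

def IsVMC {Ω : Type*} [MeasurableSpace Ω] (P : Measure Ω) (X : Ω → ℕ → Path) : Prop :=
  IsProbabilityMeasure P ∧
  Measurable X ∧
  (∀ ω N, X ω N ∈ pathSpace N) ∧
  (∀ ω N, proj N (X ω (N + 1)) = X ω N) ∧
  ∀ N, IsMarkovChain P (fun i ω => X ω N i)

def S0 {Ω : Type*} (X : Ω → ℕ → Path) (N : ℕ) (ω : Ω) : ℕ := X ω N 0

noncomputable def Vis {Ω : Type*} (X : Ω → ℕ → Path) (a : ℕ) (ω : Ω) : ℕ∞ :=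
  {k : ℕ | hitTime (X ω a) {a} k ≠ ⊤}.encard

open scoped Classical in
noncomputable def Sak {Ω : Type*} (X : Ω → ℕ → Path) (a k N : ℕ) (ω : Ω) : ℕ :=
  if (k : ℕ∞) < Vis X a ω ∧ hitTime (X ω N) {a} k ≠ ⊤ then
    X ω N ((hitTime (X ω N) {a} k).toNat + 1)
  else 0

def InfinitelyVisited {Ω : Type*} [MeasurableSpace Ω] (P : Measure Ω)
    (X : Ω → ℕ → Path) (a : ℕ) : Prop := P {ω | Vis X a ω = ⊤} = 1

def OnceVisited {Ω : Type*} [MeasurableSpace Ω] (P : Measure Ω)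
    (X : Ω → ℕ → Path) (a : ℕ) : Prop := P {ω | Vis X a ω = 1} = 1

def NeverVisited {Ω : Type*} [MeasurableSpace Ω] (P : Measure Ω)
    (X : Ω → ℕ → Path) (a : ℕ) : Prop := P {ω | Vis X a ω = 0} = 1

def RandomlyVisited {Ω : Type*} [MeasurableSpace Ω] (P : Measure Ω)
    (X : Ω → ℕ → Path) (a : ℕ) : Prop :=
  ¬ InfinitelyVisited P X a ∧ ¬ OnceVisited P X a ∧ ¬ NeverVisited P X a

def sigmaX {Ω : Type*} (X : Ω → ℕ → Path) : MeasurableSpace Ω :=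
  MeasurableSpace.comap X inferInstance

def tailVMC {Ω : Type*} (X : Ω → ℕ → Path) : MeasurableSpace Ω :=
  ⨅ N : ℕ, MeasurableSpace.comap (fun ω (M : ℕ) => X ω (N + M)) inferInstance

def TailTrivial {Ω : Type*} [MeasurableSpace Ω] (P : Measure Ω) (X : Ω → ℕ → Path) : Prop :=
  ∀ A : Set Ω, MeasurableSet[tailVMC X] A → P A = 0 ∨ P A = 1

def RepresentedBy {Ω : Type*} [MeasurableSpace Ω] (P : Measure Ω) (X : Ω → ℕ → Path)
    (ν : ℕ → ℕ → ℝ) (K : ℕ → ℕ → ℕ → ℝ) : Prop :=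
  (∀ N a, a ≤ N → (P {ω | X ω N 0 = a}).toReal = ν N a) ∧
  ∀ N a b, a ≤ N → b ≤ N → 0 < (P {ω | X ω N 0 = a}).toReal →
    (P {ω | X ω N 0 = a ∧ X ω N 1 = b}).toReal / (P {ω | X ω N 0 = a}).toReal = K N a b

noncomputable def piK (K : ℕ → ℕ → ℕ → ℝ) (N : ℕ) (b : ℕ) : ℝ :=
  if K (N + 1) (N + 1) (N + 1) < 1 then
    K (N + 1) (N + 1) b / (1 - K (N + 1) (N + 1) (N + 1))
  else if b = 0 then 1 else 0

def IsVTM (K : ℕ → ℕ → ℕ → ℝ) : Prop :=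
  (∀ N a b, 0 ≤ K N a b) ∧
  (∀ N a b, a ≤ N → N < b → K N a b = 0) ∧
  (∀ N a, a ≤ N → ∑ b ∈ Finset.range (N + 1), K N a b = 1) ∧
  (∀ N, K N 0 0 = 1) ∧
  (∀ N a b, a ≤ N → b ≤ N → K N a b = K (N + 1) a b + K (N + 1) a (N + 1) * piK K N b)

def mpow (N : ℕ) (M : ℕ → ℕ → ℝ) : ℕ → ℕ → ℕ → ℝ
  | 0 => fun a b => if a = b then 1 else 0
  | n + 1 => fun a b => ∑ c ∈ Finset.range (N + 1), mpow N M n a c * M c b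

def IsIrreducibleVTM (K : ℕ → ℕ → ℕ → ℝ) : Prop :=
  ∀ N, 1 ≤ N → ∀ a b, 1 ≤ a → a ≤ N → 1 ≤ b → b ≤ N →
    ∃ n, 0 < mpow N (K N) n a b

def IsClassical {Ω : Type*} [MeasurableSpace Ω] (P : Measure Ω) (X : Ω → ℕ → Path) : Prop :=
  ∀ᵐ ω ∂P, ∃ x : Path, x ∈ fullPathSpace ∧
    (∀ i, ∀ᶠ N in atTop, X ω N i = x i) ∧ ∀ N, X ω N = proj N x


noncomputable def intMap (μ : Measure Path) : BoundedContinuousFunction Path ℝ → ℝ :=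
  fun f => ∫ x, f x ∂μ


open Topology


def cyl (N : ℕ) (a : ℕ → ℕ) : Set Path := {S | ∀ i ≤ N, S i = a i}

def TT (b : ℕ) (S : Path) : Path := fun i => if i < b then S i else b

def sh (M : ℕ) (S : Path) : Path := fun i => S (M + i)

noncomputable def LL (π : ℕ → ℕ → ℝ) : ℕ → Measure Path
  | 0 => Measure.dirac 0
  | B + 1 => ∑ c : Fin (B + 1), ENNReal.ofReal (π B c) • (LL π c).map (TT (B + 1))

lemma meas_coord (N a : ℕ) : MeasurableSet {S : Path | S N = a} :=
  measurableSet_eq_fun (measurable_pi_apply N) measurable_const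

lemma meas_cyl (N : ℕ) (a : ℕ → ℕ) : MeasurableSet (cyl N a) := by
  have : cyl N a = ⋂ i ∈ Set.Iic N, {S : Path | S i = a i} := by
    ext S; simp [cyl]
  rw [this]
  exact MeasurableSet.biInter (Set.to_countable _) fun i _ => meas_coord i _

lemma measurable_TT (b : ℕ) : Measurable (TT b) := by
  refine measurable_pi_lambda _ fun i => ?_
  unfold TT
  by_cases h : i < b
  · simpa [h] using measurable_pi_apply i
  · simp [h]

lemma measurable_sh (M : ℕ) : Measurable (sh M) :=
  measurable_pi_lambda _ fun i => measurable_pi_apply (M + i)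

lemma meas_staircase : MeasurableSet staircaseSet := by
  have : staircaseSet = (⋂ N, {S : Path | S N ≤ N}) ∩
      ⋂ N, ({S : Path | S (N+1) = S N} ∪ {S : Path | S (N+1) = N+1}) := by
    ext S; simp [staircaseSet]
  rw [this]
  refine (MeasurableSet.iInter fun N => ?_).inter (MeasurableSet.iInter fun N => ?_)
  · exact measurableSet_le (measurable_pi_apply N) measurable_const
  · exact (measurableSet_eq_fun (measurable_pi_apply (N+1)) (measurable_pi_apply N)).union
      (meas_coord _ _)

lemma LL_succ_apply (π : ℕ → ℕ → ℝ) (B : ℕ) {A : Set Path} (hA : MeasurableSet A) :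
    LL π (B+1) A = ∑ c ∈ Finset.range (B+1), ENNReal.ofReal (π B c) * LL π c (TT (B+1) ⁻¹' A) := by
  rw [LL, ← Fin.sum_univ_eq_sum_range (fun c => ENNReal.ofReal (π B c) * LL π c (TT (B+1) ⁻¹' A))]
  simp only [Measure.coe_finsetSum, Finset.sum_apply, Measure.smul_apply, smul_eq_mul]
  refine Finset.sum_congr rfl fun c _ => ?_
  rw [Measure.map_apply (measurable_TT _) hA]

lemma LL_prob {π : ℕ → ℕ → ℝ} (hπ : IsBalayage π) (b : ℕ) : IsProbabilityMeasure (LL π b) := by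
  induction b using Nat.strong_induction_on with
  | _ b ih =>
    cases b with
    | zero => rw [LL]; infer_instance
    | succ B =>
      constructor
      rw [LL_succ_apply _ _ MeasurableSet.univ, ← ENNReal.ofReal_one, ← hπ.2.2 B,
        ENNReal.ofReal_sum_of_nonneg fun i _ => hπ.1 B i]
      refine Finset.sum_congr rfl fun c hc => ?_
      have := ih c (by simpa using hc)
      simp

lemma TT_stair {B : ℕ} {S : Path} (hS : S ∈ staircaseSet) : TT (B+1) S ∈ staircaseSet := by
  obtain ⟨h1, h2⟩ := hS
  refine ⟨fun N => ?_, fun N => ?_⟩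
  · have := h1 N
    simp only [TT]; split_ifs <;> omega
  · have := h2 N
    simp only [TT]; split_ifs <;> omega

lemma LL_ae {π : ℕ → ℕ → ℝ} (_hπ : IsBalayage π) (b : ℕ) :
    ∀ᵐ S ∂LL π b, S ∈ staircaseSet ∧ ∀ i, b ≤ i → S i = b := by
  have hm : ∀ b, MeasurableSet {S : Path | S ∈ staircaseSet ∧ ∀ i, b ≤ i → S i = b} := by
    intro b
    have : {S : Path | S ∈ staircaseSet ∧ ∀ i, b ≤ i → S i = b} =
      staircaseSet ∩ ⋂ i ∈ Set.Ici b, {S : Path | S i = b} := by ext; simp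
    rw [this]
    exact meas_staircase.inter
      (MeasurableSet.biInter (Set.to_countable _) fun i _ => meas_coord i _)
  induction b using Nat.strong_induction_on with
  | _ b ih =>
    cases b with
    | zero =>
      rw [LL, ae_dirac_iff (hm 0)]
      refine ⟨⟨fun N => by simp, fun N => by simp⟩, by simp⟩
    | succ B =>
      rw [ae_iff]
      have hm' := (hm (B+1)).compl
      change LL π (B+1) {S : Path | S ∈ staircaseSet ∧ ∀ i, B+1 ≤ i → S i = B+1}ᶜ = 0
      rw [LL_succ_apply _ _ hm', Finset.sum_eq_zero]
      intro c hc
      have h := ih c (by simpa using hc)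
      have : LL π c (TT (B+1) ⁻¹' {S : Path | S ∈ staircaseSet ∧ ∀ i, B+1 ≤ i → S i = B+1}ᶜ) = 0 := by
        have : ∀ᵐ S ∂LL π c, TT (B+1) S ∈ {S : Path | S ∈ staircaseSet ∧ ∀ i, B+1 ≤ i → S i = B+1} := by
          filter_upwards [h] with S hS
          refine ⟨TT_stair hS.1, fun i hi => ?_⟩
          simp [TT, Nat.not_lt.2 hi]
        exact this
      rw [this, mul_zero]

lemma LL_succ_real {π : ℕ → ℕ → ℝ} (hπ : IsBalayage π) (B : ℕ) {A : Set Path}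
    (hA : MeasurableSet A) :
    (LL π (B+1)).real A = ∑ c ∈ Finset.range (B+1), π B c * (LL π c).real (TT (B+1) ⁻¹' A) := by
  have := fun b => LL_prob hπ b
  rw [Measure.real, LL_succ_apply _ _ hA, ENNReal.toReal_sum]
  · refine Finset.sum_congr rfl fun c _ => ?_
    rw [ENNReal.toReal_mul, ENNReal.toReal_ofReal (hπ.1 B c), Measure.real]
  · intro c _
    exact ENNReal.mul_ne_top ENNReal.ofReal_ne_top (measure_ne_top _ _)

lemma real_congr_ae {μ : Measure Path} {A B : Set Path} {P : Path → Prop}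
    (h : ∀ᵐ S ∂μ, P S) (hAB : ∀ S, P S → (S ∈ A ↔ S ∈ B)) : μ.real A = μ.real B := by
  rw [Measure.real, Measure.real, measure_congr]
  filter_upwards [h] with S hS
  exact propext (hAB S hS)

lemma LL_real_ne {π : ℕ → ℕ → ℝ} (hπ : IsBalayage π) {b M a : ℕ} (hb : b ≤ M) (hab : a ≠ b)
    {A : Set Path} (hA : ∀ S ∈ A, S M = a) : (LL π b).real A = 0 := by
  rw [real_congr_ae (B := ∅) (LL_ae hπ b), measureReal_empty]
  intro S hS
  simp only [Set.mem_empty_iff_false, iff_false]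
  intro h
  exact hab ((hA S h).symm.trans (hS.2 M hb))

lemma LL_coord {π : ℕ → ℕ → ℝ} (hπ : IsBalayage π) {b N : ℕ} (hb : b ≤ N) (a : ℕ) :
    (LL π b).real {S | S N = a} = if a = b then 1 else 0 := by
  have := LL_prob hπ b
  split_ifs with h
  · rw [real_congr_ae (B := Set.univ) (LL_ae hπ b), probReal_univ]
    intro S hS
    simp [hS.2 N hb, h]
  · exact LL_real_ne hπ hb h fun S hS => hS

lemma TT_pre_cyl {B M : ℕ} (h : M ≤ B) (w : ℕ → ℕ) : TT (B+1) ⁻¹' cyl M w = cyl M w := by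
  ext S
  simp only [cyl, TT, Set.mem_preimage, Set.mem_ofPred_eq]
  refine forall_congr' fun i => forall_congr' fun hi => ?_
  rw [if_pos (by omega)]

lemma TT_pre_coord {B M : ℕ} (h : M ≤ B) (a : ℕ) :
    TT (B+1) ⁻¹' {S | S M = a} = {S | S M = a} := by
  ext S
  simp only [TT, Set.mem_preimage, Set.mem_ofPred_eq]
  rw [if_pos (by omega)]

/-- Markov property of `LL`. -/
lemma LG {π : ℕ → ℕ → ℝ} (hπ : IsBalayage π) (b M : ℕ) (w : ℕ → ℕ) {A : Set Path}
    (hA : MeasurableSet A) :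
    (LL π b).real (cyl M w ∩ sh M ⁻¹' A) =
      (LL π (w M)).real (cyl M w) * (LL π b).real ({S | S M = w M} ∩ sh M ⁻¹' A) := by
  have hprob := fun b => LL_prob hπ b
  induction b using Nat.strong_induction_on generalizing A with
  | _ b ih =>
    rcases le_or_gt b M with hb | hb
    · by_cases hw : w M = b
      · by_cases hc : (fun _ => b : Path) ∈ A
        · have key : ∀ C : Set Path, (LL π b).real (C ∩ sh M ⁻¹' A) = (LL π b).real C := by
            intro C
            refine real_congr_ae (LL_ae hπ b) fun S hS => ?_
            have : sh M S = fun _ => b := by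
              funext i; exact hS.2 _ (by omega)
            simp [this, hc]
          rw [key, key, LL_coord hπ hb, hw]; simp
        · have key : ∀ C : Set Path, (LL π b).real (C ∩ sh M ⁻¹' A) = 0 := by
            intro C
            rw [real_congr_ae (B := ∅) (LL_ae hπ b), measureReal_empty]
            intro S hS
            have : sh M S = fun _ => b := by
              funext i; exact hS.2 _ (by omega)
            simp [this, hc]
          rw [key, key, mul_zero]
      · rw [LL_real_ne hπ hb hw, LL_real_ne hπ hb hw, mul_zero]
        · exact fun S hS => hS.1
        · exact fun S hS => hS.1 M le_rfl
    · obtain ⟨B, rfl⟩ : ∃ B, b = B + 1 := ⟨b - 1, by omega⟩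
      let T' : Path → Path := fun R i => if M + i < B + 1 then R i else B + 1
      have hT' : Measurable T' := by
        refine measurable_pi_lambda _ fun i => ?_
        by_cases h : M + i < B + 1
        · simp only [T', if_pos h]; exact measurable_pi_apply i
        · simp only [T', if_neg h]; exact measurable_const
      have hpre : TT (B+1) ⁻¹' (sh M ⁻¹' A) = sh M ⁻¹' (T' ⁻¹' A) := by
        rw [← Set.preimage_comp, ← Set.preimage_comp]; rfl
      have hsA := measurable_sh M hA
      rw [LL_succ_real hπ B ((meas_cyl M w).inter hsA),
        LL_succ_real hπ B ((meas_coord M _).inter hsA), Finset.mul_sum]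
      refine Finset.sum_congr rfl fun c hc => ?_
      rw [Set.preimage_inter, Set.preimage_inter, TT_pre_cyl (by omega), TT_pre_coord (by omega),
        hpre, ih c (by simpa using hc) (hT' hA)]
      ring

lemma LL_pi {π : ℕ → ℕ → ℝ} (hπ : IsBalayage π) (N a : ℕ) :
    (LL π (N+1)).real {S | S N = a} = π N a := by
  rw [LL_succ_real hπ N (meas_coord _ _)]
  rw [TT_pre_coord le_rfl]
  have : ∀ c ∈ Finset.range (N+1), π N c * (LL π c).real {S | S N = a} =
      if a = c then π N c else 0 := by
    intro c hc
    rw [LL_coord hπ (by simp at hc; omega)]; simp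
  rw [Finset.sum_congr rfl this, Finset.sum_ite_eq]
  split_ifs with h
  · rfl
  · exact (hπ.2.1 N a (by simp at h; omega)).symm

lemma LL_mix {π : ℕ → ℕ → ℝ} (hπ : IsBalayage π) {N M : ℕ} (h : N ≤ M) (a : ℕ) :
    (LL π (M+1)).real {S | S N = a} =
      ∑ c ∈ Finset.range (M+1), π M c * (LL π c).real {S | S N = a} := by
  rw [LL_succ_real hπ M (meas_coord _ _), TT_pre_coord h]



def rs (N : ℕ) (S : Path) : Fin (N+1) → ℕ := fun i => S i

lemma measurable_rs (N : ℕ) : Measurable (rs N) :=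
  measurable_pi_lambda _ fun i => measurable_pi_apply (i : ℕ)

lemma meas_rs (N : ℕ) (B : Set (Fin (N+1) → ℕ)) : MeasurableSet (rs N ⁻¹' B) :=
  measurable_rs N (MeasurableSet.of_discrete)

def PP (π : ℕ → ℕ → ℝ) (μ : Measure Path) : Prop :=
  IsProbabilityMeasure μ ∧ μ staircaseSet = 1 ∧
    ∀ N w, μ.real (cyl N w) = μ.real {S | S N = w N} * (LL π (w N)).real (cyl N w)

lemma stair_ae {μ : Measure Path} [IsProbabilityMeasure μ] (h : μ staircaseSet = 1) :
    ∀ᵐ S ∂μ, S ∈ staircaseSet :=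
  (mem_ae_iff_prob_eq_one meas_staircase).2 h

lemma PP_LL {π : ℕ → ℕ → ℝ} (hπ : IsBalayage π) (b : ℕ) : PP π (LL π b) := by
  have := LL_prob hπ b
  refine ⟨this, ?_, fun N w => ?_⟩
  · refine (mem_ae_iff_prob_eq_one meas_staircase).1 ?_
    filter_upwards [LL_ae hπ b] with S hS using hS.1
  · have := LG hπ b N w MeasurableSet.univ
    simp only [Set.preimage_univ, Set.inter_univ] at this
    rw [this, mul_comm]

lemma JJ {π : ℕ → ℕ → ℝ} (hπ : IsBalayage π) {μ : Measure Path} (h : PP π μ) {b N : ℕ}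
    (hb : b ≤ N) (B : Set (Fin (N+1) → ℕ)) :
    μ.real ({S | S N = b} ∩ rs N ⁻¹' B) = μ.real {S | S N = b} * (LL π b).real (rs N ⁻¹' B) := by
  have := h.1
  have := LL_prob hπ b
  have key : (μ.restrict {S | S N = b}).map (rs N) = μ {S | S N = b} • (LL π b).map (rs N) := by
    refine Measure.ext_of_singleton fun w => ?_
    rw [Measure.map_apply (measurable_rs N) (by measurability), Measure.smul_apply,
      Measure.map_apply (measurable_rs N) (by measurability),
      Measure.restrict_apply (meas_rs N _)]
    let w' : ℕ → ℕ := fun i => if hi : i < N + 1 then w ⟨i, hi⟩ else 0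
    have hw : rs N ⁻¹' {w} = cyl N w' := by
      ext S
      simp only [Set.mem_preimage, Set.mem_singleton_iff, cyl, Set.mem_ofPred_eq]
      constructor
      · intro hS i hi
        have : i < N + 1 := by omega
        simp only [w', this, dif_pos]
        exact congrFun hS ⟨i, this⟩
      · intro hS
        funext i
        have := hS i (by omega)
        simp only [w', i.2, dif_pos] at this
        exact this
    rw [hw]
    by_cases hbw : w' N = b
    · have h3 := h.2.2 N w'
      have : cyl N w' ∩ {S | S N = b} = cyl N w' := by
        refine Set.inter_eq_left.2 fun S hS => ?_
        rw [← hbw]; exact hS N le_rfl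
      rw [this]
      rw [hbw] at h3
      rw [smul_eq_mul, ← ENNReal.toReal_eq_toReal_iff' (measure_ne_top _ _)
        (ENNReal.mul_ne_top (measure_ne_top _ _) (measure_ne_top _ _)), ENNReal.toReal_mul]
      exact h3
    · have e1 : cyl N w' ∩ {S | S N = b} = ∅ := by
        ext S
        simp only [Set.mem_inter_iff, Set.mem_empty_iff_false, iff_false]
        rintro ⟨h1, h2⟩
        exact hbw ((h1 N le_rfl).symm.trans h2)
      have e2 : LL π b (cyl N w') = 0 := by
        have := LL_real_ne hπ hb hbw (A := cyl N w') (fun S hS => hS N le_rfl)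
        rwa [measureReal_eq_zero_iff] at this
      rw [e1, e2]; simp
  have h2 := congrArg (fun ρ => ρ.real B) key
  simp only [Measure.real] at h2
  rw [Measure.map_apply (measurable_rs N) MeasurableSet.of_discrete, Measure.smul_apply,
    Measure.map_apply (measurable_rs N) MeasurableSet.of_discrete,
    Measure.restrict_apply (meas_rs N _), smul_eq_mul, ENNReal.toReal_mul] at h2
  rw [Set.inter_comm]
  exact h2

lemma sum_coord {μ : Measure Path} [IsProbabilityMeasure μ] (hs : μ staircaseSet = 1)
    (N : ℕ) {A : Set Path} (hA : MeasurableSet A) :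
    μ.real A = ∑ b ∈ Finset.range (N+1), μ.real ({S | S N = b} ∩ A) := by
  rw [← measureReal_biUnion_finset]
  · refine real_congr_ae (stair_ae hs) fun S hS => ?_
    have := hS.1 N
    simp only [Finset.mem_range, Set.mem_iUnion, Set.mem_inter_iff, Set.mem_ofPred_eq, exists_prop]
    constructor
    · intro h; exact ⟨S N, by omega, rfl, h⟩
    · rintro ⟨i, _, _, h⟩; exact h
  · intro i _ j _ hij
    rw [Function.onFun, Set.disjoint_left]
    rintro S ⟨h1, _⟩ ⟨h2, _⟩
    exact hij (h1.symm.trans h2)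
  · intro b _
    exact (meas_coord N b).inter hA

lemma JJ_sum {π : ℕ → ℕ → ℝ} (hπ : IsBalayage π) {μ : Measure Path} (h : PP π μ) (N : ℕ)
    (B : Set (Fin (N+1) → ℕ)) :
    μ.real (rs N ⁻¹' B) =
      ∑ b ∈ Finset.range (N+1), μ.real {S | S N = b} * (LL π b).real (rs N ⁻¹' B) := by
  have := h.1
  rw [sum_coord h.2.1 N (meas_rs N B)]
  exact Finset.sum_congr rfl fun b hb => JJ hπ h (by simp at hb; omega) B

lemma coord_eq_rs {M N : ℕ} (h : M ≤ N) (c : ℕ) :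
    {S : Path | S M = c} = rs N ⁻¹' {f | f ⟨M, by omega⟩ = c} := rfl

lemma joint {π : ℕ → ℕ → ℝ} (hπ : IsBalayage π) {μ : Measure Path} (h : PP π μ) {M N : ℕ}
    (hM : M ≤ N) (c b : ℕ) :
    μ.real ({S | S N = b} ∩ {S | S M = c}) =
      μ.real {S | S N = b} * (LL π b).real {S | S M = c} := by
  have := h.1
  rcases le_or_gt b N with hb | hb
  · exact JJ hπ h hb {f | f ⟨M, by omega⟩ = c}
  · have : μ.real {S | S N = b} = 0 := by
      rw [real_congr_ae (B := ∅) (stair_ae h.2.1), measureReal_empty]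
      intro S hS
      have := hS.1 N
      simp only [Set.mem_ofPred_eq, Set.mem_empty_iff_false, iff_false]
      omega
    rw [this, zero_mul]
    exact measureReal_mono_null Set.inter_subset_left this

lemma marg_zero {μ : Measure Path} [IsProbabilityMeasure μ] (hs : μ staircaseSet = 1)
    {N b : ℕ} (hb : N < b) {A : Set Path} (hA : ∀ S ∈ A, S N = b) : μ.real A = 0 := by
  rw [real_congr_ae (B := ∅) (stair_ae hs), measureReal_empty]
  intro S hS
  have := hS.1 N
  simp only [Set.mem_empty_iff_false, iff_false]
  intro h
  have := hA S h
  omega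

lemma marg_zero' {μ : Measure Path} [IsProbabilityMeasure μ] (hs : μ staircaseSet = 1)
    {N b : ℕ} (hb : N < b) : μ.real {S | S N = b} = 0 :=
  marg_zero hs hb (fun _ hS => hS)

lemma cyl_succ_rec {π : ℕ → ℕ → ℝ} (hπ : IsBalayage π) (N : ℕ) (a : ℕ → ℕ) (_ha : a N ≤ N)
    (ha' : a (N+1) ≤ N + 1) :
    (LL π (a (N+1))).real (cyl (N+1) a) =
      (LL π (a (N+1))).real {S | S N = a N} * (LL π (a N)).real (cyl N a) := by
  have hp := LL_prob hπ (a (N+1))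
  have : (LL π (a (N+1))).real (cyl (N+1) a) = (LL π (a (N+1))).real (cyl N a) := by
    refine real_congr_ae (LL_ae hπ _) fun S hS => ?_
    constructor
    · intro h i hi; exact h i (by omega)
    · intro h i hi
      rcases Nat.lt_or_ge N i with h1 | h1
      · obtain rfl : i = N + 1 := by omega
        exact hS.2 _ ha'
      · exact h i h1
  rw [this]
  exact (PP_LL hπ (a (N+1))).2.2 N a

lemma PP_of_PMCpi {π : ℕ → ℕ → ℝ} (hπ : IsBalayage π) {μ : Measure Path} (h : μ ∈ PMCpi π) :
    PP π μ := by
  obtain ⟨⟨hp, hs, hM⟩, hpi⟩ := h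
  refine ⟨hp, hs, fun N w => ?_⟩
  -- two-point law
  have two : ∀ N a b, b ≤ N + 1 → μ.real {S | S N = a ∧ S (N+1) = b} =
      μ.real {S | S (N+1) = b} * (LL π b).real {S | S N = a} := by
    intro N a b hb
    rcases Nat.lt_or_ge N b with hb' | hb'
    · obtain rfl : b = N + 1 := by omega
      rw [LL_pi hπ]
      rcases le_or_gt a N with ha | ha
      · rcases (measureReal_nonneg (μ := μ) (s := {S | S (N+1) = N+1})).eq_or_lt' with h0 | h0
        · rw [h0, zero_mul]
          exact measureReal_mono_null (fun S hS => hS.2) h0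
        · have := hpi N a ha h0
          change μ.real _ / μ.real _ = _ at this
          rw [div_eq_iff h0.ne'] at this
          rw [mul_comm]; exact this
      · rw [hπ.2.1 N a ha, mul_zero]
        exact marg_zero hs ha (fun S hS => hS.1)
    · rw [LL_coord hπ hb']
      split_ifs with hab
      · rw [mul_one]
        refine real_congr_ae (stair_ae hs) fun S hS => ?_
        have := hS.2 N
        simp only [Set.mem_ofPred_eq]
        omega
      · rw [mul_zero, real_congr_ae (B := ∅) (stair_ae hs), measureReal_empty]
        intro S hS
        have := hS.2 N
        simp only [Set.mem_ofPred_eq, Set.mem_empty_iff_false, iff_false]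
        omega
  induction N with
  | zero =>
    rcases Nat.eq_zero_or_pos (w 0) with h0 | h0
    · have e : cyl 0 w = {S | S 0 = w 0} := by ext; simp [cyl]
      rw [e, h0, LL_coord hπ le_rfl]; simp
    · rw [marg_zero hs h0 (A := cyl 0 w) (fun S hS => hS 0 le_rfl),
        marg_zero' hs h0, zero_mul]
  | succ N ih =>
    rcases le_or_gt (w (N+1)) (N+1) with h1 | h1
    swap
    · rw [marg_zero hs h1 (A := cyl (N+1) w) (fun S hS => hS _ le_rfl),
        marg_zero' hs h1, zero_mul]
    rcases le_or_gt (w N) N with h2 | h2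
    swap
    · have := LL_prob hπ (w (N+1))
      rw [marg_zero hs h2 (A := cyl (N+1) w) (fun S hS => hS _ (by omega)),
        marg_zero (μ := LL π (w (N+1))) (PP_LL hπ _).2.1 h2
          (A := cyl (N+1) w) (fun S hS => hS _ (by omega)), mul_zero]
    rw [cyl_succ_rec hπ N w h2 h1, ← mul_assoc, ← two N (w N) (w (N+1)) h1]
    have hcs : cyl (N+1) w = {S | (∀ i ≤ N, S i = w i) ∧ S (N+1) = w (N+1)} := by
      ext S
      simp only [cyl, Set.mem_ofPred_eq]
      constructor
      · intro h; exact ⟨fun i hi => h i (by omega), h _ le_rfl⟩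
      · rintro ⟨ha, hb⟩ i hi
        rcases Nat.lt_or_ge N i with h1 | h1
        · obtain rfl : i = N + 1 := by omega
          exact hb
        · exact ha i h1
    rcases (measureReal_nonneg (μ := μ) (s := cyl N w)).eq_or_lt' with h0 | h0
    · have : μ.real (cyl (N+1) w) = 0 := by
        exact measureReal_mono_null (s₂ := cyl N w) (fun S hS i hi => hS i (by omega)) h0
      rw [this]
      rw [ih] at h0
      rcases mul_eq_zero.1 h0 with h0 | h0
      · have : μ.real {S | S N = w N ∧ S (N+1) = w (N+1)} = 0 :=
          measureReal_mono_null (fun S hS => hS.1) h0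
        rw [this, zero_mul]
      · rw [h0, mul_zero]
    · have hm := hM N w h0
      have hN : 0 < μ.real {S | S N = w N} :=
        lt_of_lt_of_le h0 (measureReal_mono fun S hS => hS N le_rfl)
      change μ.real _ / μ.real (cyl N w) = μ.real _ / μ.real _ at hm
      rw [← hcs, div_eq_div_iff h0.ne' hN.ne', ih] at hm
      have : μ.real {S | S N = w N} * (μ.real (cyl (N + 1) w)) = μ.real {S | S N = w N} *
        (μ.real {S | S N = w N ∧ S (N + 1) = w (N + 1)} * (LL π (w N)).real (cyl N w)) := by
        linarith
      exact mul_left_cancel₀ hN.ne' this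

lemma PMCpi_of_PP {π : ℕ → ℕ → ℝ} (hπ : IsBalayage π) {μ : Measure Path} (h : PP π μ) :
    μ ∈ PMCpi π := by
  have hp := h.1
  have hs := h.2.1
  have two : ∀ N a b, μ.real {S | S N = a ∧ S (N+1) = b} =
      μ.real {S | S (N+1) = b} * (LL π b).real {S | S N = a} := by
    intro N a b
    rw [← joint hπ h (by omega)]
    congr 1
    ext S; simp [and_comm]
  refine ⟨⟨hp, hs, fun N w h0 => ?_⟩, fun N a ha h0 => ?_⟩
  · have hcs : cyl (N+1) w = {S | (∀ i ≤ N, S i = w i) ∧ S (N+1) = w (N+1)} := by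
      ext S
      simp only [cyl, Set.mem_ofPred_eq]
      constructor
      · intro h; exact ⟨fun i hi => h i (by omega), h _ le_rfl⟩
      · rintro ⟨ha, hb⟩ i hi
        rcases Nat.lt_or_ge N i with h1 | h1
        · obtain rfl : i = N + 1 := by omega
          exact hb
        · exact ha i h1
    change 0 < μ.real (cyl N w) at h0
    change μ.real _ / μ.real (cyl N w) = μ.real _ / μ.real _
    rw [← hcs]
    have hN : 0 < μ.real {S | S N = w N} :=
        lt_of_lt_of_le h0 (measureReal_mono fun S hS => hS N le_rfl)
    rw [div_eq_div_iff h0.ne' hN.ne', h.2.2, h.2.2 N, two]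
    have h2 : w N ≤ N := by
      by_contra hc
      rw [marg_zero' hs (not_le.1 hc)] at hN
      exact hN.false
    rcases le_or_gt (w (N+1)) (N+1) with h1 | h1
    · rw [cyl_succ_rec hπ N w h2 h1]; ring
    · rw [marg_zero' hs h1]; ring
  · change μ.real _ / μ.real _ = _
    change 0 < μ.real _ at h0
    rw [two, LL_pi hπ, mul_div_cancel_left₀ _ h0.ne']

lemma PMCpi_iff {π : ℕ → ℕ → ℝ} (hπ : IsBalayage π) {μ : Measure Path} :
    μ ∈ PMCpi π ↔ PP π μ := ⟨PP_of_PMCpi hπ, PMCpi_of_PP hπ⟩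



lemma ext_rs {ρ₁ ρ₂ : Measure Path} [IsFiniteMeasure ρ₁] [IsFiniteMeasure ρ₂]
    (h : ∀ N (B : Set (Fin (N+1) → ℕ)), ρ₁ (rs N ⁻¹' B) = ρ₂ (rs N ⁻¹' B)) : ρ₁ = ρ₂ := by
  have hm : ∀ I : Finset ℕ, Measurable (I.restrict : Path → (I → ℕ)) := fun I =>
    measurable_pi_lambda _ fun i => measurable_pi_apply (i : ℕ)
  refine IsProjectiveLimit.unique (P := fun I => ρ₂.map I.restrict) ?_ (fun I => rfl)
  intro I
  ext s hs
  rw [Measure.map_apply (hm I) hs, Measure.map_apply (hm I) hs]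
  have hI : ∀ i ∈ I, i < I.sup id + 1 := fun i hi => Nat.lt_succ_of_le (Finset.le_sup (f := id) hi)
  have := h (I.sup id) {f | (fun i : I => f ⟨i, hI i i.2⟩) ∈ s}
  exact this

lemma ext_marg {π : ℕ → ℕ → ℝ} (hπ : IsBalayage π) {μ₁ μ₂ : Measure Path}
    (h1 : PP π μ₁) (h2 : PP π μ₂) (h : marginals μ₁ = marginals μ₂) : μ₁ = μ₂ := by
  have := h1.1
  have := h2.1
  refine ext_rs fun N B => ?_
  have : μ₁.real (rs N ⁻¹' B) = μ₂.real (rs N ⁻¹' B) := by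
    rw [JJ_sum hπ h1, JJ_sum hπ h2]
    refine Finset.sum_congr rfl fun b _ => ?_
    congr 1
    exact congrFun (congrFun h N) b
  rwa [measureReal_def, measureReal_def, ENNReal.toReal_eq_toReal_iff' (measure_ne_top _ _) (measure_ne_top _ _)] at this

lemma tailMarkov {π : ℕ → ℕ → ℝ} (hπ : IsBalayage π) {μ : Measure Path} (h : PP π μ)
    (M : ℕ) (w : ℕ → ℕ) {A : Set Path} (hA : MeasurableSet A) :
    μ.real (cyl M w ∩ sh M ⁻¹' A) =
      (LL π (w M)).real (cyl M w) * μ.real ({S | S M = w M} ∩ sh M ⁻¹' A) := by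
  have hp := h.1
  have := LL_prob hπ (w M)
  have key : (μ.restrict (cyl M w)).map (sh M) =
      (LL π (w M) (cyl M w)) • (μ.restrict {S | S M = w M}).map (sh M) := by
    have : IsFiniteMeasure ((LL π (w M) (cyl M w)) • (μ.restrict {S | S M = w M}).map (sh M)) := by
      refine Measure.smul_finite _ (measure_ne_top _ _)
    refine ext_rs fun k B => ?_
    have hmB := meas_rs k B
    rw [Measure.map_apply (measurable_sh M) hmB, Measure.smul_apply,
      Measure.map_apply (measurable_sh M) hmB, Measure.restrict_apply (measurable_sh M hmB),
      Measure.restrict_apply (measurable_sh M hmB), smul_eq_mul,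
      ← ENNReal.toReal_eq_toReal_iff' (measure_ne_top _ _)
        (ENNReal.mul_ne_top (measure_ne_top _ _) (measure_ne_top _ _)), ENNReal.toReal_mul,
      Set.inter_comm, Set.inter_comm _ {S : Path | S M = w M}]
    change μ.real (cyl M w ∩ sh M ⁻¹' (rs k ⁻¹' B)) = (LL π (w M)).real (cyl M w) *
      μ.real ({S | S M = w M} ∩ sh M ⁻¹' (rs k ⁻¹' B))
    have e1 : cyl M w ∩ sh M ⁻¹' (rs k ⁻¹' B) = rs (M + k) ⁻¹'
      {f | (∀ i (hi : i ≤ M), f ⟨i, by omega⟩ = w i) ∧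
        (fun i : Fin (k+1) => f ⟨M + i, by omega⟩) ∈ B} := rfl
    have e2 : {S : Path | S M = w M} ∩ sh M ⁻¹' (rs k ⁻¹' B) = rs (M + k) ⁻¹'
      {f | (f ⟨M, by omega⟩ = w M) ∧
        (fun i : Fin (k+1) => f ⟨M + i, by omega⟩) ∈ B} := rfl
    rw [e1, e2, JJ_sum hπ h, JJ_sum hπ h, ← e1, ← e2, Finset.mul_sum]
    refine Finset.sum_congr rfl fun b _ => ?_
    rw [LG hπ b M w hmB]
    ring
  have h2 := congrArg (fun ρ => ρ.real A) key
  simp only [measureReal_def] at h2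
  rw [Measure.map_apply (measurable_sh M) hA, Measure.smul_apply,
      Measure.map_apply (measurable_sh M) hA, Measure.restrict_apply (measurable_sh M hA),
      Measure.restrict_apply (measurable_sh M hA), smul_eq_mul, ENNReal.toReal_mul,
      Set.inter_comm, Set.inter_comm _ {S : Path | S M = w M}] at h2
  exact h2

lemma tail_eq {A : Set Path} (hA : MeasurableSet[pathTail] A) (N : ℕ) :
    ∃ A' : Set Path, MeasurableSet A' ∧ sh N ⁻¹' A' = A := by
  have : pathTail ≤ MeasurableSpace.comap (sh N) inferInstance := iInf_le _ N
  exact this A hA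

lemma tail_meas {A : Set Path} (hA : MeasurableSet[pathTail] A) : MeasurableSet A := by
  obtain ⟨A', h, rfl⟩ := tail_eq hA 0
  exact measurable_sh 0 h

lemma PP_cond {π : ℕ → ℕ → ℝ} (hπ : IsBalayage π) {μ : Measure Path} (h : PP π μ)
    {A : Set Path} (hA : MeasurableSet[pathTail] A) (h0 : μ A ≠ 0) :
    PP π (ProbabilityTheory.cond μ A) := by
  have hp := h.1
  have hmA := tail_meas hA
  have hc := ProbabilityTheory.cond_isProbabilityMeasure h0
  have hr : ∀ B, (ProbabilityTheory.cond μ A).real B = (μ.real A)⁻¹ * μ.real (B ∩ A) := by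
    intro B
    rw [measureReal_def, ProbabilityTheory.cond_apply hmA, ENNReal.toReal_mul, ENNReal.toReal_inv,
      Set.inter_comm]
    rfl
  refine ⟨hc, ?_, fun N w => ?_⟩
  · refine (mem_ae_iff_prob_eq_one meas_staircase).1 ?_
    exact ProbabilityTheory.cond_absolutelyContinuous.ae_le (stair_ae h.2.1)
  · obtain ⟨A', hA', rfl⟩ := tail_eq hA N
    rw [hr, hr, tailMarkov hπ h N w hA']
    ring

lemma PP_mix {π : ℕ → ℕ → ℝ} {μ₁ μ₂ : Measure Path} (h1 : PP π μ₁) (h2 : PP π μ₂)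
    {s t : ℝ≥0∞} (hst : s + t = 1) : PP π (s • μ₁ + t • μ₂) := by
  have := h1.1
  have := h2.1
  have hs : s ≠ ∞ := fun h => by simp [h] at hst
  have ht : t ≠ ∞ := fun h => by simp [h] at hst
  have hr : ∀ B, (s • μ₁ + t • μ₂).real B = s.toReal * μ₁.real B + t.toReal * μ₂.real B := by
    intro B
    rw [measureReal_def, Measure.add_apply, Measure.smul_apply, Measure.smul_apply, smul_eq_mul,
      smul_eq_mul, ENNReal.toReal_add, ENNReal.toReal_mul, ENNReal.toReal_mul]
    · rfl
    · exact ENNReal.mul_ne_top hs (measure_ne_top _ _)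
    · exact ENNReal.mul_ne_top ht (measure_ne_top _ _)
  refine ⟨⟨by simp [hst]⟩, by simp [h1.2.1, h2.2.1, hst], fun N w => ?_⟩
  rw [hr, hr, h1.2.2, h2.2.2]
  ring

lemma intMap_mix {μ₁ μ₂ : Measure Path} [IsProbabilityMeasure μ₁] [IsProbabilityMeasure μ₂]
    {s t : ℝ≥0∞} (hst : s + t = 1) :
    intMap (s • μ₁ + t • μ₂) = s.toReal • intMap μ₁ + t.toReal • intMap μ₂ := by
  have hs : s ≠ ∞ := fun h => by simp [h] at hst
  have ht : t ≠ ∞ := fun h => by simp [h] at hst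
  funext f
  have h1 : Integrable f μ₁ := f.integrable μ₁
  have h2 : Integrable f μ₂ := f.integrable μ₂
  simp only [intMap, Pi.add_apply, Pi.smul_apply]
  rw [integral_add_measure (h1.smul_measure hs) (h2.smul_measure ht), integral_smul_measure,
    integral_smul_measure]

/-! Topology -/

lemma clopen_rs (N : ℕ) (B : Set (Fin (N+1) → ℕ)) : IsClopen (rs N ⁻¹' B) := by
  have hc : Continuous (rs N) := continuous_pi fun i => continuous_apply (i : ℕ)
  exact (isClopen_discrete B).preimage hc

lemma integral_ind {Ω : Type*} [TopologicalSpace Ω] [MeasurableSpace Ω] [OpensMeasurableSpace Ω]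
    (μ : Measure Ω) {B : Set Ω} (hB : IsClopen B) :
    ∫ x, BoundedContinuousFunction.indicator B hB x ∂μ = μ.real B := by
  change ∫ x, B.indicator 1 x ∂μ = _
  rw [integral_indicator_one hB.isOpen.measurableSet]

lemma continuous_real_clopen {Ω : Type*} [TopologicalSpace Ω] [MeasurableSpace Ω]
    [OpensMeasurableSpace Ω] {B : Set Ω} (hB : IsClopen B) :
    Continuous fun μ : ProbabilityMeasure Ω => (μ : Measure Ω).real B := by
  have := ProbabilityMeasure.continuous_integral_boundedContinuousFunction
    (BoundedContinuousFunction.indicator B hB)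
  simpa only [integral_ind] using this

lemma clopen_coord (N a : ℕ) : IsClopen {S : Path | S N = a} :=
  clopen_rs N {f | f ⟨N, by omega⟩ = a}

lemma clopen_cyl (N : ℕ) (w : ℕ → ℕ) : IsClopen (cyl N w) :=
  clopen_rs N {f | ∀ i (hi : i ≤ N), f ⟨i, by omega⟩ = w i}

lemma closed_staircase : IsClosed staircaseSet := by
  have : staircaseSet = (⋂ N, {S : Path | S N ≤ N}) ∩
      ⋂ N, ({S : Path | S (N+1) = S N} ∪ {S : Path | S (N+1) = N+1}) := by
    ext S; simp [staircaseSet]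
  rw [this]
  refine (isClosed_iInter fun N => ?_).inter (isClosed_iInter fun N => ?_)
  · exact isClosed_le (continuous_apply N) continuous_const
  · exact (isClosed_eq (continuous_apply (N+1)) (continuous_apply N)).union
      (clopen_coord _ _).isClosed

lemma compact_staircase : IsCompact staircaseSet := by
  have h : IsCompact (Set.pi Set.univ fun N : ℕ => Set.Iic N) :=
    isCompact_univ_pi fun N => (Set.finite_Iic N).isCompact
  exact h.of_isClosed_subset closed_staircase fun S hS N _ => hS.1 N

def CC (π : ℕ → ℕ → ℝ) : Set (ProbabilityMeasure Path) := {μ | PP π (μ : Measure Path)}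

lemma compact_CC (π : ℕ → ℕ → ℝ) : IsCompact (CC π) := by
  have : CompactSpace staircaseSet := isCompact_iff_compactSpace.1 compact_staircase
  let F : ProbabilityMeasure staircaseSet → ProbabilityMeasure Path :=
    fun μ => μ.map continuous_subtype_val.measurable.aemeasurable
  have hF : Continuous F := ProbabilityMeasure.continuous_map continuous_subtype_val
  let C' : Set (ProbabilityMeasure staircaseSet) := {μ | ∀ N w,
    (F μ : Measure Path).real (cyl N w) = (F μ : Measure Path).real {S | S N = w N} *
      (LL π (w N)).real (cyl N w)}
  have hC' : IsClosed C' := by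
    have : C' = ⋂ N, ⋂ w, {μ | (F μ : Measure Path).real (cyl N w) =
      (F μ : Measure Path).real {S | S N = w N} * (LL π (w N)).real (cyl N w)} := by
      ext μ; simp only [C', Set.mem_ofPred_eq, Set.mem_iInter]
    rw [this]
    refine isClosed_iInter fun N => isClosed_iInter fun w => isClosed_eq ?_ ?_
    · exact (continuous_real_clopen (clopen_cyl N w)).comp hF
    · exact ((continuous_real_clopen (clopen_coord N (w N))).comp hF).mul continuous_const
  have hstair : ∀ μ, (F μ : Measure Path) staircaseSet = 1 := by
    intro μ
    change Measure.map Subtype.val (μ : Measure staircaseSet) staircaseSet = 1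
    rw [Measure.map_apply continuous_subtype_val.measurable meas_staircase]
    simp
  have : CC π = F '' C' := by
    ext μ
    constructor
    · intro h
      have h2 : (μ : Measure Path).restrict staircaseSet = μ :=
        Measure.restrict_eq_self_of_ae_mem (stair_ae h.2.1)
      have h3 : Measure.map Subtype.val (Measure.comap (Subtype.val : staircaseSet → Path) μ) = μ := by
        rw [map_comap_subtype_coe meas_staircase, h2]
      have hp : IsProbabilityMeasure (Measure.comap (Subtype.val : staircaseSet → Path) μ) := by
        constructor
        have := congrArg (fun ρ => ρ Set.univ) h3
        beta_reduce at this
        rw [Measure.map_apply continuous_subtype_val.measurable MeasurableSet.univ] at this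
        simpa using this
      have hFe : F ⟨_, hp⟩ = μ := by
        apply Subtype.ext
        exact h3
      refine ⟨⟨_, hp⟩, ?_, hFe⟩
      intro N w
      rw [hFe]; exact h.2.2 N w
    · rintro ⟨μ, h, rfl⟩
      exact ⟨inferInstance, hstair μ, h⟩
  rw [this]
  exact hC'.isCompact.image hF

lemma image_CC {X : Type*} {π : ℕ → ℕ → ℝ} (hπ : IsBalayage π) (G : Measure Path → X) :
    G '' PMCpi π = (fun μ : ProbabilityMeasure Path => G μ) '' CC π := by
  ext x
  constructor
  · rintro ⟨μ, h, rfl⟩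
    rw [PMCpi_iff hπ] at h
    exact ⟨⟨μ, h.1⟩, h, rfl⟩
  · rintro ⟨μ, h, rfl⟩
    exact ⟨μ, (PMCpi_iff hπ).2 h, rfl⟩

lemma compact_intMap {π : ℕ → ℕ → ℝ} (hπ : IsBalayage π) : IsCompact (intMap '' PMCpi π) := by
  rw [image_CC hπ]
  refine (compact_CC π).image ?_
  exact continuous_pi fun f => ProbabilityMeasure.continuous_integral_boundedContinuousFunction f

lemma compact_marg {π : ℕ → ℕ → ℝ} (hπ : IsBalayage π) : IsCompact (marginals '' PMCpi π) := by
  rw [image_CC hπ]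
  refine (compact_CC π).image ?_
  exact continuous_pi fun N => continuous_pi fun a => continuous_real_clopen (clopen_coord N a)

lemma convex_intMap {π : ℕ → ℕ → ℝ} (hπ : IsBalayage π) : Convex ℝ (intMap '' PMCpi π) := by
  rintro _ ⟨μ₁, h1, rfl⟩ _ ⟨μ₂, h2, rfl⟩ a b ha hb hab
  rw [PMCpi_iff hπ] at h1 h2
  have := h1.1
  have := h2.1
  have hst : ENNReal.ofReal a + ENNReal.ofReal b = 1 := by
    rw [← ENNReal.ofReal_add ha hb, hab, ENNReal.ofReal_one]
  refine ⟨ENNReal.ofReal a • μ₁ + ENNReal.ofReal b • μ₂, (PMCpi_iff hπ).2 (PP_mix h1 h2 hst), ?_⟩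
  rw [intMap_mix hst, ENNReal.toReal_ofReal ha, ENNReal.toReal_ofReal hb]



abbrev EE : Type := ℕ → ℕ → ℝ

noncomputable def hh (π : ℕ → ℕ → ℝ) (b : ℕ) : EE := marginals (LL π b)

lemma hh_apply (π : ℕ → ℕ → ℝ) (b N a : ℕ) : hh π b N a = (LL π b).real {S | S N = a} := rfl

lemma hh_le {π : ℕ → ℕ → ℝ} (hπ : IsBalayage π) {b N : ℕ} (hb : b ≤ N) (a : ℕ) :
    hh π b N a = if a = b then 1 else 0 := LL_coord hπ hb a

lemma hh_succ {π : ℕ → ℕ → ℝ} (hπ : IsBalayage π) {N M : ℕ} (h : N ≤ M) (a : ℕ) :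
    hh π (M+1) N a = ∑ c ∈ Finset.range (M+1), π M c * hh π c N a := LL_mix hπ h a

lemma marg_Dpi {π : ℕ → ℕ → ℝ} (hπ : IsBalayage π) {μ : Measure Path} (h : PP π μ) :
    marginals μ ∈ Dpi π := by
  have hp := h.1
  have hs := h.2.1
  have heq : ∀ N a, a ≤ N → marginals μ N a =
      marginals μ (N+1) a + marginals μ (N+1) (N+1) * π N a := by
    intro N a ha
    have := JJ_sum hπ h (N+1) {f | f ⟨N, by omega⟩ = a}
    change marginals μ N a = ∑ b ∈ Finset.range (N+1+1), marginals μ (N+1) b * hh π b N a at this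
    rw [this, Finset.sum_range_succ]
    congr 1
    · rw [Finset.sum_eq_single a]
      · rw [hh_le hπ ha]; simp
      · intro b hb hba
        rw [hh_le hπ (by simp at hb; omega), if_neg hba.symm, mul_zero]
      · intro h; simp at h; omega
    · rw [hh_apply, LL_pi hπ]
  refine ⟨⟨fun N a => measureReal_nonneg, fun N a ha => marg_zero' hs ha, fun N => ?_,
    fun N a ha => ?_⟩, heq⟩
  · have := sum_coord hs N MeasurableSet.univ
    simp only [Set.inter_univ, probReal_univ] at this
    exact this.symm
  · rw [heq N a ha]
    have : 0 ≤ marginals μ (N+1) (N+1) * π N a := mul_nonneg measureReal_nonneg (hπ.1 N a)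
    linarith

lemma hh_Dpi {π : ℕ → ℕ → ℝ} (hπ : IsBalayage π) (b : ℕ) : hh π b ∈ Dpi π :=
  marg_Dpi hπ (PP_LL hπ b)

/-- generic recursion -/
lemma Dpi_step {π : ℕ → ℕ → ℝ} {ν : EE} (hν : ν ∈ Dpi π) (M : ℕ) (g : ℕ → ℝ) :
    ∑ b ∈ Finset.range (M+1), ν M b * g b = ∑ b ∈ Finset.range (M+1), ν (M+1) b * g b +
      ν (M+1) (M+1) * ∑ c ∈ Finset.range (M+1), π M c * g c := by
  rw [Finset.mul_sum, ← Finset.sum_add_distrib]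
  refine Finset.sum_congr rfl fun b hb => ?_
  rw [hν.2 M b (by simp at hb; omega)]
  ring

lemma Dpi_rep {π : ℕ → ℕ → ℝ} (hπ : IsBalayage π) {ν : EE} (hν : ν ∈ Dpi π) {N M : ℕ}
    (h : N ≤ M) (a : ℕ) : ∑ b ∈ Finset.range (M+1), ν M b * hh π b N a = ν N a := by
  induction M, h using Nat.le_induction with
  | base =>
    rcases le_or_gt a N with ha | ha
    · rw [Finset.sum_eq_single a]
      · rw [hh_le hπ ha]; simp
      · intro b hb hba
        rw [hh_le hπ (by simp at hb; omega), if_neg hba.symm, mul_zero]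
      · intro h; simp at h; omega
    · rw [hν.1.2.1 N a ha]
      refine Finset.sum_eq_zero fun b hb => ?_
      simp at hb
      rw [hh_le hπ (by omega), if_neg (by omega), mul_zero]
  | succ M hM ih =>
    rw [Finset.sum_range_succ, hh_succ hπ hM, ← Dpi_step hν, ih]

lemma Dpi_nonneg {π : ℕ → ℕ → ℝ} {ν : EE} (hν : ν ∈ Dpi π) (N a : ℕ) : 0 ≤ ν N a := hν.1.1 N a

lemma Dpi_le_one {π : ℕ → ℕ → ℝ} {ν : EE} (hν : ν ∈ Dpi π) (N a : ℕ) : ν N a ≤ 1 := by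
  rcases le_or_gt a N with ha | ha
  · rw [← hν.1.2.2.1 N]
    exact Finset.single_le_sum (f := fun a => ν N a) (fun i _ => hν.1.1 N i) (by simp; omega)
  · rw [hν.1.2.1 N a ha]; norm_num

lemma convex_Dpi (π : ℕ → ℕ → ℝ) : Convex ℝ (Dpi π) := by
  intro x hx y hy s t hs ht hst
  have heq : ∀ N a, (s • x + t • y) N a = s * x N a + t * y N a := fun N a => rfl
  refine ⟨⟨fun N a => ?_, fun N a ha => ?_, fun N => ?_, fun N a ha => ?_⟩, fun N a ha => ?_⟩
  · rw [heq]
    exact add_nonneg (mul_nonneg hs (hx.1.1 N a)) (mul_nonneg ht (hy.1.1 N a))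
  · rw [heq, hx.1.2.1 N a ha, hy.1.2.1 N a ha]; simp
  · simp only [heq]
    rw [Finset.sum_add_distrib, ← Finset.mul_sum, ← Finset.mul_sum, hx.1.2.2.1, hy.1.2.2.1]
    linarith
  · rw [heq, heq]
    exact add_le_add (mul_le_mul_of_nonneg_left (hx.1.2.2.2 N a ha) hs)
      (mul_le_mul_of_nonneg_left (hy.1.2.2.2 N a ha) ht)
  · simp only [heq]
    rw [hx.2 N a ha, hy.2 N a ha]; ring

lemma mixM_mem {π : ℕ → ℕ → ℝ} (hπ : IsBalayage π) {ν : EE} (hν : ν ∈ Dpi π) (M : ℕ) :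
    ∑ b ∈ Finset.range (M+1), ν M b • hh π b ∈ Dpi π :=
  (convex_Dpi π).sum_mem (fun b _ => hν.1.1 M b) (hν.1.2.2.1 M) (fun b _ => hh_Dpi hπ b)

lemma mixM_tendsto {π : ℕ → ℕ → ℝ} (hπ : IsBalayage π) {ν : EE} (hν : ν ∈ Dpi π) :
    Tendsto (fun M => ∑ b ∈ Finset.range (M+1), ν M b • hh π b) atTop (𝓝 ν) := by
  refine tendsto_pi_nhds.2 fun N => tendsto_pi_nhds.2 fun a => ?_
  refine tendsto_const_nhds.congr' ?_
  filter_upwards [eventually_ge_atTop N] with M hM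
  rw [← Dpi_rep hπ hν hM a]
  simp [Finset.sum_apply]

lemma convex_marg {π : ℕ → ℕ → ℝ} (hπ : IsBalayage π) : Convex ℝ (marginals '' PMCpi π) := by
  rintro _ ⟨μ₁, h1, rfl⟩ _ ⟨μ₂, h2, rfl⟩ a b ha hb hab
  rw [PMCpi_iff hπ] at h1 h2
  have := h1.1
  have := h2.1
  have hst : ENNReal.ofReal a + ENNReal.ofReal b = 1 := by
    rw [← ENNReal.ofReal_add ha hb, hab, ENNReal.ofReal_one]
  refine ⟨ENNReal.ofReal a • μ₁ + ENNReal.ofReal b • μ₂, (PMCpi_iff hπ).2 (PP_mix h1 h2 hst), ?_⟩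
  funext N c
  have := congrFun (intMap_mix (μ₁ := μ₁) (μ₂ := μ₂) hst)
    (BoundedContinuousFunction.indicator _ (clopen_coord N c))
  simp only [intMap, Pi.add_apply, Pi.smul_apply, integral_ind, ENNReal.toReal_ofReal ha,
    ENNReal.toReal_ofReal hb] at this
  exact this

lemma marg_eq_Dpi {π : ℕ → ℕ → ℝ} (hπ : IsBalayage π) : marginals '' PMCpi π = Dpi π := by
  apply Set.Subset.antisymm
  · rintro _ ⟨μ, h, rfl⟩
    exact marg_Dpi hπ ((PMCpi_iff hπ).1 h)
  · intro ν hν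
    refine (compact_marg hπ).isClosed.mem_of_tendsto (mixM_tendsto hπ hν) (Eventually.of_forall fun M => ?_)
    refine (convex_marg hπ).sum_mem (fun b _ => hν.1.1 M b) (hν.1.2.2.1 M) (fun b _ => ?_)
    exact ⟨LL π b, (PMCpi_iff hπ).2 (PP_LL hπ b), rfl⟩

lemma compact_Dpi {π : ℕ → ℕ → ℝ} (hπ : IsBalayage π) : IsCompact (Dpi π) := by
  rw [← marg_eq_Dpi hπ]; exact compact_marg hπ

lemma affine_sum {K : Set EE} (hK : Convex ℝ K) {f : EE → ℝ} (hf : AffineOn f K) {ι : Type*}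
    (s : Finset ι) (c : ι → ℝ) (p : ι → EE) (hc : ∀ i ∈ s, 0 ≤ c i) (hs : ∑ i ∈ s, c i = 1)
    (hp : ∀ i ∈ s, p i ∈ K) : f (∑ i ∈ s, c i • p i) = ∑ i ∈ s, c i * f (p i) := by
  have h1 : ConvexOn ℝ K f := by
    refine ⟨hK, fun x hx y hy a b ha hb hab => le_of_eq ?_⟩
    obtain rfl : b = 1 - a := by linarith
    exact hf x hx y hy a ha (by linarith)
  have h2 : ConcaveOn ℝ K f := by
    refine ⟨hK, fun x hx y hy a b ha hb hab => le_of_eq ?_⟩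
    obtain rfl : b = 1 - a := by linarith
    exact (hf x hx y hy a ha (by linarith)).symm
  exact le_antisymm (h1.map_sum_le hc hs hp) (h2.le_map_sum hc hs hp)

/-- second moments -/
noncomputable def VM (π : ℕ → ℕ → ℝ) (N a M : ℕ) (ν : EE) : ℝ :=
  ∑ b ∈ Finset.range (M+1), ν M b * (hh π b N a)^2

lemma jensen_sq {s : Finset ℕ} {c g : ℕ → ℝ} (hc : ∀ i ∈ s, 0 ≤ c i) (hs : ∑ i ∈ s, c i = 1) :
    (∑ i ∈ s, c i * g i)^2 ≤ ∑ i ∈ s, c i * (g i)^2 := by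
  have := (convexOn_pow (𝕜 := ℝ) (n := 2)).1
  have h := (even_two.convexOn_pow (𝕜 := ℝ)).map_sum_le hc hs (p := g) (fun i _ => Set.mem_univ _)
  simpa using h

lemma VM_step {π : ℕ → ℕ → ℝ} (hπ : IsBalayage π) {ν : EE} (hν : ν ∈ Dpi π) {N M : ℕ}
    (h : N ≤ M) (a : ℕ) : VM π N a (M+1) ν ≤ VM π N a M ν := by
  unfold VM
  rw [Dpi_step hν M, Finset.sum_range_succ, hh_succ hπ h]
  have := jensen_sq (s := Finset.range (M+1)) (c := π M) (g := fun c => hh π c N a)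
    (fun i _ => hπ.1 M i) (hπ.2.2 M)
  have := mul_le_mul_of_nonneg_left this (hν.1.1 (M+1) (M+1))
  linarith

lemma VM_lower {π : ℕ → ℕ → ℝ} (hπ : IsBalayage π) {ν : EE} (hν : ν ∈ Dpi π) {N M : ℕ}
    (h : N ≤ M) (a : ℕ) : (ν N a)^2 ≤ VM π N a M ν := by
  rw [← Dpi_rep hπ hν h a]
  exact jensen_sq (fun i _ => hν.1.1 M i) (hν.1.2.2.1 M)

lemma VM_nonneg {π : ℕ → ℕ → ℝ} {ν : EE} (hν : ν ∈ Dpi π) (N a M : ℕ) : 0 ≤ VM π N a M ν :=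
  Finset.sum_nonneg fun b _ => mul_nonneg (hν.1.1 M b) (sq_nonneg _)

lemma VM_le_one {π : ℕ → ℕ → ℝ} (hπ : IsBalayage π) {ν : EE} (hν : ν ∈ Dpi π) (N a M : ℕ) :
    VM π N a M ν ≤ 1 := by
  rw [← hν.1.2.2.1 M]
  refine Finset.sum_le_sum fun b _ => ?_
  have h0 := Dpi_nonneg (hh_Dpi hπ b) N a
  have h1 := Dpi_le_one (hh_Dpi hπ b) N a
  exact mul_le_of_le_one_right (hν.1.1 M b) (by nlinarith)

noncomputable def VV (π : ℕ → ℕ → ℝ) (N a : ℕ) (ν : EE) : ℝ := ⨅ k, VM π N a (N + k) ν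

lemma VV_tendsto {π : ℕ → ℕ → ℝ} (hπ : IsBalayage π) {ν : EE} (hν : ν ∈ Dpi π) (N a : ℕ) :
    Tendsto (fun M => VM π N a M ν) atTop (𝓝 (VV π N a ν)) := by
  have h : Tendsto (fun k => VM π N a (N + k) ν) atTop (𝓝 (VV π N a ν)) := by
    refine tendsto_atTop_ciInf (antitone_nat_of_succ_le fun k => ?_) ?_
    · exact VM_step hπ hν (Nat.le_add_right N k) a
    · exact ⟨0, by rintro _ ⟨k, rfl⟩; exact VM_nonneg hν _ _ _⟩
  simp_rw [add_comm N] at h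
  exact (tendsto_add_atTop_iff_nat N).1 h

lemma VV_lower {π : ℕ → ℕ → ℝ} (hπ : IsBalayage π) {ν : EE} (hν : ν ∈ Dpi π) (N a : ℕ) :
    (ν N a)^2 ≤ VV π N a ν :=
  le_ciInf fun k => VM_lower hπ hν (by omega) a

lemma VM_affine (π : ℕ → ℕ → ℝ) (N a M : ℕ) (x y : EE) (s t : ℝ) :
    VM π N a M (s • x + t • y) = s * VM π N a M x + t * VM π N a M y := by
  unfold VM
  rw [Finset.mul_sum, Finset.mul_sum, ← Finset.sum_add_distrib]
  refine Finset.sum_congr rfl fun b _ => ?_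
  simp only [Pi.add_apply, Pi.smul_apply, smul_eq_mul]; ring

lemma VM_cont (π : ℕ → ℕ → ℝ) (N a M : ℕ) : Continuous (VM π N a M) := by
  unfold VM; fun_prop

lemma VV_affine {π : ℕ → ℕ → ℝ} (hπ : IsBalayage π) {x y : EE} (hx : x ∈ Dpi π) (hy : y ∈ Dpi π)
    {s t : ℝ} (hs : 0 ≤ s) (ht : 0 ≤ t) (hst : s + t = 1) (N a : ℕ) :
    VV π N a (s • x + t • y) = s * VV π N a x + t * VV π N a y := by
  have h := VV_tendsto hπ (convex_Dpi π hx hy hs ht hst) N a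
  refine tendsto_nhds_unique h ?_
  simp_rw [VM_affine]
  exact ((VV_tendsto hπ hx N a).const_mul s).add ((VV_tendsto hπ hy N a).const_mul t)

lemma VV_meas (π : ℕ → ℕ → ℝ) (N a : ℕ) : Measurable (VV π N a) :=
  Measurable.iInf fun k => (VM_cont π N a (N+k)).measurable

/-- the V-condition -/
def GG (π : ℕ → ℕ → ℝ) : Set EE := {ν | ν ∈ Dpi π ∧ ∀ N a, VV π N a ν = (ν N a)^2}

lemma GG_meas {π : ℕ → ℕ → ℝ} (hπ : IsBalayage π) : MeasurableSet (GG π) := by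
  have : GG π = Dpi π ∩ ⋂ N, ⋂ a, {ν | VV π N a ν = (ν N a)^2} := by ext; simp [GG]
  rw [this]
  refine (compact_Dpi hπ).isClosed.measurableSet.inter
    (MeasurableSet.iInter fun N => MeasurableSet.iInter fun a => ?_)
  refine measurableSet_eq_fun (VV_meas π N a) ?_
  exact (Continuous.measurable (by fun_prop))

lemma GG_ext {π : ℕ → ℕ → ℝ} (hπ : IsBalayage π) {ν x y : EE} (hν : ν ∈ GG π)
    (hx : x ∈ Dpi π) (hy : y ∈ Dpi π) {s t : ℝ} (hs : 0 < s) (ht : 0 < t) (hst : s + t = 1)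
    (h : s • x + t • y = ν) : x = ν := by
  have hxy : x = y := by
    funext N a
    have h1 := hν.2 N a
    rw [← h, VV_affine hπ hx hy hs.le ht.le hst] at h1
    have h2 := VV_lower hπ hx N a
    have h3 := VV_lower hπ hy N a
    simp only [Pi.add_apply, Pi.smul_apply, smul_eq_mul] at h1
    have h4 : s * t * (x N a - y N a)^2 ≤ 0 := by
      have := mul_le_mul_of_nonneg_left h2 hs.le
      have := mul_le_mul_of_nonneg_left h3 ht.le
      obtain rfl : t = 1 - s := by linarith
      nlinarith
    have h5 : (x N a - y N a)^2 = 0 := by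
      have := mul_pos hs ht
      nlinarith [sq_nonneg (x N a - y N a)]
    have := pow_eq_zero_iff (two_ne_zero) |>.1 h5
    linarith
  rw [← h, ← hxy, ← add_smul, hst, one_smul]

lemma GG_sub_ext {π : ℕ → ℕ → ℝ} (hπ : IsBalayage π) :
    GG π ⊆ Set.extremePoints ℝ (Dpi π) := by
  intro ν hν
  refine ⟨hν.1, ?_⟩
  rintro x hx y hy ⟨s, t, hs, ht, hst, h⟩
  exact GG_ext hπ hν hx hy hs ht hst h



lemma exists_rep {π : ℕ → ℕ → ℝ} (hπ : IsBalayage π) {x : EE} (hx : x ∈ Dpi π)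
    (U : Ultrafilter ℕ) :
    ∃ m : Measure EE, IsProbabilityMeasure m ∧ (∀ᵐ y ∂m, y ∈ Dpi π) ∧
      ∀ g : EE → ℝ, ContinuousOn g (Dpi π) →
        Tendsto (fun M => ∑ b ∈ Finset.range (M+1), x M b * g (hh π b)) U (𝓝 (∫ y, g y ∂m)) := by
  have hK := (compact_Dpi hπ).isClosed.measurableSet
  have : CompactSpace (Dpi π) := isCompact_iff_compactSpace.1 (compact_Dpi hπ)
  let q : ℕ → Dpi π := fun b => ⟨hh π b, hh_Dpi hπ b⟩
  let ρ : ℕ → ProbabilityMeasure (Dpi π) := fun M =>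
    ⟨∑ b ∈ Finset.range (M+1), ENNReal.ofReal (x M b) • Measure.dirac (q b), ⟨by
      simp only [Measure.coe_finsetSum, Finset.sum_apply, Measure.smul_apply, smul_eq_mul,
        measure_univ, mul_one]
      rw [← ENNReal.ofReal_sum_of_nonneg (fun b _ => hx.1.1 M b), hx.1.2.2.1 M, ENNReal.ofReal_one]⟩⟩
  obtain ⟨m', -, hm'⟩ := isCompact_univ.ultrafilter_le_nhds (U.map ρ) (by simp)
  have hm : Tendsto ρ U (𝓝 m') := hm'
  rw [ProbabilityMeasure.tendsto_iff_forall_integral_tendsto] at hm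
  refine ⟨(m' : Measure (Dpi π)).map Subtype.val,
    Measure.isProbabilityMeasure_map measurable_subtype_coe.aemeasurable, ?_, ?_⟩
  · exact (ae_map_iff (p := fun y => y ∈ Dpi π) measurable_subtype_coe.aemeasurable hK).2
      (Eventually.of_forall fun y => y.2)
  · intro g hg
    rw [(MeasurableEmbedding.subtype_coe hK).integral_map]
    have hc : Continuous (fun y : Dpi π => g y) := continuousOn_iff_continuous_domRestrict.1 hg
    have := hm (BoundedContinuousFunction.mkOfCompact ⟨_, hc⟩)
    refine this.congr fun M => ?_
    change ∫ ω, g (ω : EE) ∂(∑ b ∈ Finset.range (M+1), ENNReal.ofReal (x M b) • Measure.dirac (q b)) = _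
    rw [integral_finsetSum_measure]
    · refine Finset.sum_congr rfl fun b _ => ?_
      rw [integral_smul_measure, integral_dirac, ENNReal.toReal_ofReal (hx.1.1 M b)]
      rfl
    · intro b _
      refine Integrable.smul_measure ?_ ENNReal.ofReal_ne_top
      exact (BoundedContinuousFunction.mkOfCompact ⟨_, hc⟩).integrable _

lemma rep_affine {π : ℕ → ℕ → ℝ} (hπ : IsBalayage π) {x : EE} (hx : x ∈ Dpi π)
    {f : EE → ℝ} (hf : ContinuousOn f (Dpi π)) (ha : AffineOn f (Dpi π)) :
    Tendsto (fun M => ∑ b ∈ Finset.range (M+1), x M b * f (hh π b)) atTop (𝓝 (f x)) := by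
  have h : ∀ M, ∑ b ∈ Finset.range (M+1), x M b * f (hh π b) =
      f (∑ b ∈ Finset.range (M+1), x M b • hh π b) := fun M =>
    (affine_sum (convex_Dpi π) ha _ _ _ (fun b _ => hx.1.1 M b) (hx.1.2.2.1 M)
      (fun b _ => hh_Dpi hπ b)).symm
  simp_rw [h]
  exact (hf x hx).tendsto.comp (tendsto_nhdsWithin_iff.2
    ⟨mixM_tendsto hπ hx, Eventually.of_forall fun M => mixM_mem hπ hx M⟩)

lemma int_K {π : ℕ → ℕ → ℝ} {m : Measure EE} [IsProbabilityMeasure m]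
    (hm : ∀ᵐ y ∂m, y ∈ Dpi π) {g : EE → ℝ} (hg : Measurable g) (C : ℝ)
    (hC : ∀ y ∈ Dpi π, |g y| ≤ C) : Integrable g m := by
  refine Integrable.of_bound hg.aestronglyMeasurable C ?_
  filter_upwards [hm] with y hy using hC y hy

lemma meas_ev (N a : ℕ) : Measurable (fun y : EE => y N a) :=
  Continuous.measurable (by fun_prop)

lemma abs_ev {π : ℕ → ℕ → ℝ} {y : EE} (hy : y ∈ Dpi π) (N a : ℕ) : |y N a| ≤ 1 := by
  rw [abs_of_nonneg (Dpi_nonneg hy N a)]; exact Dpi_le_one hy N a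

lemma ev_affine (π : ℕ → ℕ → ℝ) (N a : ℕ) : AffineOn (fun y : EE => y N a) (Dpi π) := by
  intro x _ y _ t _ _
  simp

/-- basic package -/
lemma exists_rep' {π : ℕ → ℕ → ℝ} (hπ : IsBalayage π) {x : EE} (hx : x ∈ Dpi π)
    (U : Ultrafilter ℕ) (hU : (U : Filter ℕ) ≤ atTop) :
    ∃ m : Measure EE, IsProbabilityMeasure m ∧ (∀ᵐ y ∂m, y ∈ Dpi π) ∧
      RepresentsOn m (Dpi π) x ∧ (∀ N a, ∫ y, (y N a)^2 ∂m = VV π N a x) ∧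
      ∀ g : EE → ℝ, ContinuousOn g (Dpi π) →
        Tendsto (fun M => ∑ b ∈ Finset.range (M+1), x M b * g (hh π b)) U (𝓝 (∫ y, g y ∂m)) := by
  obtain ⟨m, h1, h2, h3⟩ := exists_rep hπ hx U
  refine ⟨m, h1, h2, ?_, ?_, h3⟩
  · intro f hf ha
    exact tendsto_nhds_unique ((rep_affine hπ hx hf ha).mono_left hU) (h3 f hf)
  · intro N a
    refine tendsto_nhds_unique (h3 (fun y => (y N a)^2) (by fun_prop)) ?_
    exact (VV_tendsto hπ hx N a).mono_left hU

lemma GG_conv {π : ℕ → ℕ → ℝ} (hπ : IsBalayage π) {ν : EE} (hν : ν ∈ GG π)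
    {g : EE → ℝ} (hg : Continuous g) :
    Tendsto (fun M => ∑ b ∈ Finset.range (M+1), ν M b * g (hh π b)) atTop (𝓝 (g ν)) := by
  rw [tendsto_iff_ultrafilter]
  intro U hU
  obtain ⟨m, h1, h2, h3, h4, h5⟩ := exists_rep' hπ hν.1 U hU
  have hae : ∀ᵐ y ∂m, y = ν := by
    have : ∀ N a, ∀ᵐ y ∂m, y N a = ν N a := by
      intro N a
      have hi1 : Integrable (fun y : EE => y N a) m :=
        int_K h2 (meas_ev N a) 1 fun y hy => abs_ev hy N a
      have hi2 : Integrable (fun y : EE => (y N a)^2) m :=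
        int_K h2 ((meas_ev N a).pow_const 2) 1 fun y hy => by
          rw [abs_pow]; exact pow_le_one₀ (abs_nonneg _) (abs_ev hy N a)
      have e1 : ν N a = ∫ y, y N a ∂m := h3 (fun y => y N a) (by fun_prop) (ev_affine π N a)
      have e2 : ∫ y, (y N a)^2 ∂m = (ν N a)^2 := by rw [h4, hν.2]
      have e3 : ∫ y, (y N a - ν N a)^2 ∂m = 0 := by
        have : ∀ y : EE, (y N a - ν N a)^2 = (y N a)^2 - 2 * ν N a * y N a + (ν N a)^2 := by
          intro y; ring
        simp_rw [this]
        have hi3 : Integrable (fun y : EE => (y N a)^2 - 2 * ν N a * y N a) m :=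
          hi2.sub (hi1.const_mul _)
        rw [integral_add hi3 (integrable_const _),
          integral_sub hi2 (hi1.const_mul _), integral_const_mul, ← e1, e2]
        simp; ring
      rw [integral_eq_zero_iff_of_nonneg (fun y => sq_nonneg _)] at e3
      · filter_upwards [e3] with y hy
        have : (y N a - ν N a)^2 = 0 := hy
        have := pow_eq_zero_iff two_ne_zero |>.1 this
        linarith
      · refine int_K h2 (((meas_ev N a).sub_const _).pow_const 2) 1 fun y hy => ?_
        have := Dpi_nonneg hy N a
        have := Dpi_le_one hy N a
        have := Dpi_nonneg hν.1 N a
        have := Dpi_le_one hν.1 N a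
        rw [abs_pow]; refine pow_le_one₀ (abs_nonneg _) (abs_le.2 ⟨by linarith, by linarith⟩)
    filter_upwards [ae_all_iff.2 fun N => ae_all_iff.2 (this N)] with y hy
    funext N a
    exact hy N a
  have : ∫ y, g y ∂m = g ν := by
    rw [integral_congr_ae (g := fun _ => g ν) (by filter_upwards [hae] with y hy; rw [hy])]
    simp
  rw [← this]
  exact h5 g hg.continuousOn

lemma VM_int {π : ℕ → ℕ → ℝ} (hπ : IsBalayage π) {m : Measure EE} [IsProbabilityMeasure m]
    (hm : ∀ᵐ y ∂m, y ∈ Dpi π) {x : EE} (hr : RepresentsOn m (Dpi π) x) (hx : x ∈ Dpi π) (N a : ℕ) :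
    ∫ y, VV π N a y ∂m = VV π N a x := by
  have h : ∀ M, ∫ y, VM π N a M y ∂m = VM π N a M x := fun M =>
    (hr (VM π N a M) (VM_cont π N a M).continuousOn
      (fun y _ z _ t _ _ => VM_affine π N a M y z t (1-t))).symm
  have h1 : Tendsto (fun M => ∫ y, VM π N a M y ∂m) atTop (𝓝 (∫ y, VV π N a y ∂m)) := by
    refine tendsto_integral_of_dominated_convergence (fun _ => 1)
      (fun M => (VM_cont π N a M).measurable.aestronglyMeasurable) (integrable_const _) ?_ ?_
    · intro M
      filter_upwards [hm] with y hy
      rw [Real.norm_eq_abs, abs_of_nonneg (VM_nonneg hy N a M)]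
      exact VM_le_one hπ hy N a M
    · filter_upwards [hm] with y hy using VV_tendsto hπ hy N a
  simp_rw [h] at h1
  exact tendsto_nhds_unique h1 (VV_tendsto hπ hx N a)

lemma VV_le_one {π : ℕ → ℕ → ℝ} (hπ : IsBalayage π) {ν : EE} (hν : ν ∈ Dpi π) (N a : ℕ) :
    VV π N a ν ≤ 1 :=
  le_of_tendsto (VV_tendsto hπ hν N a) (Eventually.of_forall fun M => VM_le_one hπ hν N a M)

lemma rep_GG {π : ℕ → ℕ → ℝ} (hπ : IsBalayage π) {m : Measure EE} [IsProbabilityMeasure m]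
    (hm : ∀ᵐ y ∂m, y ∈ Dpi π) {x : EE} (hr : RepresentsOn m (Dpi π) x) (hx : x ∈ Dpi π)
    (h2 : ∀ N a, ∫ y, (y N a)^2 ∂m = VV π N a x) : m (GG π) = 1 := by
  refine (mem_ae_iff_prob_eq_one (GG_meas hπ)).1 ?_
  have : ∀ N a, ∀ᵐ y ∂m, VV π N a y = (y N a)^2 := by
    intro N a
    have hi2 : Integrable (fun y : EE => (y N a)^2) m :=
      int_K hm ((meas_ev N a).pow_const 2) 1 fun y hy => by
        rw [abs_pow]; exact pow_le_one₀ (abs_nonneg _) (abs_ev hy N a)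
    have hiV : Integrable (VV π N a) m :=
      int_K hm (VV_meas π N a) 1 fun y hy => by
        rw [abs_of_nonneg ((sq_nonneg _).trans (VV_lower hπ hy N a))]
        exact VV_le_one hπ hy N a
    have e : ∫ y, (VV π N a y - (y N a)^2) ∂m = 0 := by
      rw [integral_sub hiV hi2, VM_int hπ hm hr hx, h2, sub_self]
    have hi3 : Integrable (fun y : EE => VV π N a y - (y N a)^2) m := hiV.sub hi2
    rw [integral_eq_zero_iff_of_nonneg_ae ?_ hi3] at e
    · filter_upwards [e] with y hy
      exact sub_eq_zero.1 hy
    · filter_upwards [hm] with y hy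
      exact sub_nonneg.2 (VV_lower hπ hy N a)
  filter_upwards [hm, ae_all_iff.2 fun N => ae_all_iff.2 (this N)] with y h1 h2
  exact ⟨h1, h2⟩

lemma weight_mem {π : ℕ → ℕ → ℝ} {m : Measure EE} [IsProbabilityMeasure m]
    (hm : ∀ᵐ y ∂m, y ∈ Dpi π) {φ : EE → ℝ} (hφ : Measurable φ)
    (h0 : ∀ y ∈ Dpi π, 0 ≤ φ y) (h1 : ∀ y ∈ Dpi π, φ y ≤ 1) {c : ℝ} (hc : 0 < c)
    (hi : ∫ y, φ y ∂m = c) : (fun N a => (∫ y, φ y * y N a ∂m) / c) ∈ Dpi π := by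
  have hint : ∀ N a, Integrable (fun y => φ y * y N a) m := fun N a =>
    int_K hm (hφ.mul (meas_ev N a)) 1 fun y hy => by
      rw [abs_of_nonneg (mul_nonneg (h0 y hy) (Dpi_nonneg hy N a))]
      exact mul_le_one₀ (h1 y hy) (Dpi_nonneg hy N a) (Dpi_le_one hy N a)
  refine ⟨⟨fun N a => ?_, fun N a ha => ?_, fun N => ?_, fun N a ha => ?_⟩, fun N a ha => ?_⟩
  · refine div_nonneg (integral_nonneg_of_ae ?_) hc.le
    filter_upwards [hm] with y hy using mul_nonneg (h0 y hy) (Dpi_nonneg hy N a)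
  · have : ∫ y, φ y * y N a ∂m = 0 := integral_eq_zero_of_ae ?_
    · simp only [this, zero_div]
    filter_upwards [hm] with y hy
    rw [hy.1.2.1 N a ha]; simp
  · rw [← Finset.sum_div, ← integral_finsetSum _ (fun a _ => hint N a), div_eq_one_iff_eq hc.ne', ← hi]
    refine integral_congr_ae ?_
    filter_upwards [hm] with y hy
    rw [← Finset.mul_sum, hy.1.2.2.1 N, mul_one]
  · refine div_le_div_of_nonneg_right (integral_mono_ae (hint _ _) (hint _ _) ?_) hc.le
    filter_upwards [hm] with y hy
    exact mul_le_mul_of_nonneg_left (hy.1.2.2.2 N a ha) (h0 y hy)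
  · have : ∫ y, φ y * y N a ∂m = ∫ y, φ y * y (N+1) a ∂m + (∫ y, φ y * y (N+1) (N+1) ∂m) * π N a := by
      rw [← integral_mul_const, ← integral_add (hint _ _) ((hint _ _).mul_const _)]
      refine integral_congr_ae ?_
      filter_upwards [hm] with y hy
      rw [hy.2 N a ha]; ring
    simp only [this]
    ring

lemma ext_sub_GG {π : ℕ → ℕ → ℝ} (hπ : IsBalayage π) :
    Set.extremePoints ℝ (Dpi π) ⊆ GG π := by
  intro ν hν
  refine ⟨hν.1, fun N a => ?_⟩
  obtain ⟨m, i1, hm, h3, h4, -⟩ := exists_rep' hπ hν.1 (hyperfilter ℕ) Nat.hyperfilter_le_atTop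
  rw [← h4]
  have hi1 : ∀ N a, Integrable (fun y : EE => y N a) m := fun N a =>
        int_K hm (meas_ev N a) 1 fun y hy => abs_ev hy N a
  have hi2 : ∀ N' a', Integrable (fun y : EE => y N a * y N' a') m := fun N' a' =>
        int_K hm ((meas_ev N a).mul (meas_ev N' a')) 1 fun y hy => by
          rw [abs_mul]; exact mul_le_one₀ (abs_ev hy N a) (abs_nonneg _) (abs_ev hy _ _)
  have e1 : ∀ N a, ∫ y, y N a ∂m = ν N a := fun N a =>
    (h3 (fun y => y N a) (by fun_prop) (ev_affine π N a)).symm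
  have n0 := Dpi_nonneg hν.1 N a
  have n1 := Dpi_le_one hν.1 N a
  set c : ℝ := (1 + ν N a) / 4 with hcdef
  have hc : ∫ y, (1 + y N a) / 4 ∂m = c := by
    rw [integral_div, integral_add (integrable_const _) (hi1 N a), e1]; simp [hcdef]
  have hc' : ∫ y, (1 - (1 + y N a) / 4) ∂m = 1 - c := by
    have hi3 : Integrable (fun y : EE => (1 + y N a) / 4) m :=
      ((integrable_const (1:ℝ)).add (hi1 N a)).div_const _
    rw [integral_sub (integrable_const _) hi3, hc]
    simp
  have hcp : 0 < c := by rw [hcdef]; linarith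
  have hcp' : 0 < 1 - c := by rw [hcdef]; linarith
  have mφ : Measurable (fun y : EE => (1 + y N a) / 4) := ((meas_ev N a).const_add 1).div_const 4
  have m1 := weight_mem hm mφ
    (fun y hy => by have := Dpi_nonneg hy N a; linarith)
    (fun y hy => by have := Dpi_le_one hy N a; linarith) hcp hc
  have m2 := weight_mem hm (φ := fun y : EE => 1 - (1 + y N a) / 4) (mφ.const_sub 1)
    (fun y hy => by have := Dpi_le_one hy N a; linarith)
    (fun y hy => by have := Dpi_nonneg hy N a; linarith) hcp' hc'
  have key := hν.2 m1 m2 ⟨c, 1 - c, hcp, hcp', by ring, ?_⟩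
  · have := congrFun (congrFun key N) a
    rw [div_eq_iff hcp.ne'] at this
    have h5 : ∫ y, (1 + y N a) / 4 * y N a ∂m = (ν N a + ∫ y, (y N a)^2 ∂m) / 4 := by
      rw [← e1 N a]
      have h6 : ∀ y : EE, (1 + y N a) / 4 * y N a = (y N a + y N a * y N a) / 4 := fun y => by ring
      simp_rw [h6, pow_two]
      rw [integral_div, integral_add (hi1 N a) (hi2 N a)]
    rw [h5, hcdef] at this
    nlinarith
  · funext N' a'
    simp only [Pi.add_apply, Pi.smul_apply, smul_eq_mul]
    rw [mul_div_cancel₀ _ hcp.ne', mul_div_cancel₀ _ hcp'.ne', ← integral_add, ← e1 N' a']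
    · refine integral_congr_ae (Eventually.of_forall fun y => ?_)
      simp only; ring
    · have : (fun y : EE => (1 + y N a) / 4 * y N' a') =
        fun y => (y N' a' + y N a * y N' a') / 4 := by funext y; ring
      rw [this]
      exact ((hi1 _ _).add (hi2 _ _)).div_const _
    · have : (fun y : EE => (1 - (1 + y N a) / 4) * y N' a') =
        fun y => y N' a' - (y N' a' + y N a * y N' a') / 4 := by funext y; ring
      rw [this]
      exact (hi1 _ _).sub (((hi1 _ _).add (hi2 _ _)).div_const _)

lemma rep_limit {π : ℕ → ℕ → ℝ} (hπ : IsBalayage π) {m : Measure EE} [IsProbabilityMeasure m]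
    (hm : ∀ᵐ y ∂m, y ∈ GG π) {x : EE} (hr : RepresentsOn m (Dpi π) x)
    (g : BoundedContinuousFunction EE ℝ) :
    Tendsto (fun M => ∑ b ∈ Finset.range (M+1), x M b * g (hh π b)) atTop (𝓝 (∫ y, g y ∂m)) := by
  have hK : ∀ᵐ y ∂m, y ∈ Dpi π := by filter_upwards [hm] with y hy using hy.1
  have h : ∀ M, ∫ y : EE, ∑ b ∈ Finset.range (M+1), y M b * g (hh π b) ∂m =
      ∑ b ∈ Finset.range (M+1), x M b * g (hh π b) := by
    intro M
    rw [integral_finsetSum]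
    · refine Finset.sum_congr rfl fun b _ => ?_
      rw [integral_mul_const, hr (fun y => y M b) (by fun_prop) (ev_affine π M b)]
    · intro b _
      exact (int_K hK (meas_ev M b) 1 fun y hy => abs_ev hy M b).mul_const _
  simp_rw [← h]
  refine tendsto_integral_of_dominated_convergence (fun _ => ‖g‖)
      (fun M => (Continuous.measurable (by fun_prop)).aestronglyMeasurable) (integrable_const _) ?_ ?_
  · intro M
    filter_upwards [hK] with y hy
    refine (norm_sum_le _ _).trans ?_
    have : ‖g‖ = ∑ b ∈ Finset.range (M+1), y M b * ‖g‖ := by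
      rw [← Finset.sum_mul, hy.1.2.2.1 M, one_mul]
    rw [this]
    refine Finset.sum_le_sum fun b _ => ?_
    rw [norm_mul, Real.norm_eq_abs, abs_of_nonneg (hy.1.1 M b)]
    exact mul_le_mul_of_nonneg_left (g.norm_coe_le_norm _) (hy.1.1 M b)
  · filter_upwards [hm] with y hy using GG_conv hπ hy g.continuous

lemma choquet {π : ℕ → ℕ → ℝ} (hπ : IsBalayage π) : IsChoquetSimplex (Dpi π) := by
  intro x hx
  have hext : Set.extremePoints ℝ (Dpi π) = GG π :=
    Set.Subset.antisymm (ext_sub_GG hπ) (GG_sub_ext hπ)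
  rw [hext]
  obtain ⟨m, i1, hm, h3, h4, -⟩ := exists_rep' hπ hx (hyperfilter ℕ) Nat.hyperfilter_le_atTop
  have hG := rep_GG hπ hm h3 hx h4
  refine ⟨m, ⟨i1, hG, h3⟩, ?_⟩
  rintro m₂ ⟨i2, hG2, hr2⟩
  refine ext_of_forall_integral_eq_of_IsFiniteMeasure fun g => ?_
  exact tendsto_nhds_unique
    (rep_limit hπ ((mem_ae_iff_prob_eq_one (GG_meas hπ)).2 hG2) hr2 g)
    (rep_limit hπ ((mem_ae_iff_prob_eq_one (GG_meas hπ)).2 hG) h3 g)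



lemma int2 {π : ℕ → ℕ → ℝ} (hπ : IsBalayage π) {μ : Measure Path} (h : PP π μ) {M N : ℕ}
    (hM : M ≤ N) (G : ℕ → ℕ → ℝ) :
    ∫ S, G (S N) (S M) ∂μ = ∑ b ∈ Finset.range (N+1), marginals μ N b *
      ∑ c ∈ Finset.range (M+1), hh π b M c * G b c := by
  have := h.1
  have e : ∀ᵐ S ∂μ, G (S N) (S M) = ∑ b ∈ Finset.range (N+1), ∑ c ∈ Finset.range (M+1),
      ({S : Path | S N = b} ∩ {S | S M = c}).indicator (fun _ => G b c) S := by
    filter_upwards [stair_ae h.2.1] with S hS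
    have h1 := hS.1 N
    have h2 := hS.1 M
    rw [Finset.sum_eq_single (S N), Finset.sum_eq_single (S M)]
    · rw [Set.indicator_of_mem]; exact ⟨rfl, rfl⟩
    · intro c _ hc
      rw [Set.indicator_of_notMem]; rintro ⟨_, h3⟩; exact hc h3.symm
    · intro h3; simp at h3; omega
    · intro b _ hb
      refine Finset.sum_eq_zero fun c _ => ?_
      rw [Set.indicator_of_notMem]; rintro ⟨h3, _⟩; exact hb h3.symm
    · intro h3; simp at h3; omega
  have hms : ∀ b c, MeasurableSet ({S : Path | S N = b} ∩ {S | S M = c}) := fun b c =>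
    (meas_coord N b).inter (meas_coord M c)
  have hi : ∀ b c, Integrable
      (({S : Path | S N = b} ∩ {S | S M = c}).indicator (fun _ => G b c)) μ := fun b c =>
    (integrable_const _).indicator (hms b c)
  rw [integral_congr_ae e, integral_finsetSum _ (fun b _ => integrable_finsetSum _ fun c _ => hi b c)]
  refine Finset.sum_congr rfl fun b _ => ?_
  rw [integral_finsetSum _ (fun c _ => hi b c), Finset.mul_sum]
  refine Finset.sum_congr rfl fun c _ => ?_
  rw [integral_indicator_const _ (hms b c), joint hπ h hM, smul_eq_mul, mul_assoc]
  rfl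

lemma int1 {π : ℕ → ℕ → ℝ} (hπ : IsBalayage π) {μ : Measure Path} (h : PP π μ) (N : ℕ)
    (g : ℕ → ℝ) : ∫ S, g (S N) ∂μ = ∑ b ∈ Finset.range (N+1), marginals μ N b * g b := by
  rw [int2 hπ h (le_refl N) (fun b _ => g b)]
  refine Finset.sum_congr rfl fun b _ => ?_
  rw [← Finset.sum_mul, (hh_Dpi hπ b).1.2.2.1, one_mul]

lemma int_diff {π : ℕ → ℕ → ℝ} (hπ : IsBalayage π) {μ : Measure Path} (h : PP π μ) {N M M' : ℕ}
    (hN : N ≤ M) (hM : M ≤ M') (a : ℕ) :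
    ∫ S, (hh π (S M') N a - hh π (S M) N a)^2 ∂μ =
      VM π N a M (marginals μ) - VM π N a M' (marginals μ) := by
  rw [int2 hπ h hM (fun b c => (hh π b N a - hh π c N a)^2)]
  have hν := marg_Dpi hπ h
  have e1 : ∀ b, ∑ c ∈ Finset.range (M+1), hh π b M c * (hh π b N a - hh π c N a)^2 =
      ∑ c ∈ Finset.range (M+1), hh π b M c * (hh π c N a)^2 - (hh π b N a)^2 := by
    intro b
    have e2 : ∀ c, hh π b M c * (hh π b N a - hh π c N a)^2 = hh π b M c * (hh π b N a)^2
      - 2 * hh π b N a * (hh π b M c * hh π c N a) + hh π b M c * (hh π c N a)^2 := by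
      intro c; ring
    simp_rw [e2]
    rw [Finset.sum_add_distrib, Finset.sum_sub_distrib, ← Finset.sum_mul, ← Finset.mul_sum,
      (hh_Dpi hπ b).1.2.2.1, Dpi_rep hπ (hh_Dpi hπ b) hN]
    ring
  simp_rw [e1, mul_sub]
  rw [Finset.sum_sub_distrib]
  congr 1
  simp_rw [Finset.mul_sum]
  rw [Finset.sum_comm]
  unfold VM
  refine Finset.sum_congr rfl fun c _ => ?_
  simp_rw [← mul_assoc]
  rw [← Finset.sum_mul, Dpi_rep hπ hν hM]

lemma meas_XX (π : ℕ → ℕ → ℝ) (N a M : ℕ) : Measurable (fun S : Path => hh π (S M) N a) :=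
  (measurable_of_countable (fun b : ℕ => hh π b N a)).comp (measurable_pi_apply M)

lemma abs_hh {π : ℕ → ℕ → ℝ} (hπ : IsBalayage π) (b N a : ℕ) : |hh π b N a| ≤ 1 :=
  abs_ev (hh_Dpi hπ b) N a

lemma int_diff_symm {π : ℕ → ℕ → ℝ} (hπ : IsBalayage π) {μ : Measure Path} (h : PP π μ)
    {N M M' : ℕ} (hN : N ≤ M) (hN' : N ≤ M') (a : ℕ) :
    ∫ S, (hh π (S M') N a - hh π (S M) N a)^2 ∂μ ≤
      |VM π N a M (marginals μ) - VM π N a M' (marginals μ)| := by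
  rcases le_total M M' with hM | hM
  · rw [int_diff hπ h hN hM]; exact le_abs_self _
  · have : ∀ S : Path, (hh π (S M') N a - hh π (S M) N a)^2 =
      (hh π (S M) N a - hh π (S M') N a)^2 := fun S => by ring
    simp_rw [this]
    rw [int_diff hπ h hN' hM, abs_sub_comm]; exact le_abs_self _

lemma triv_GG {π : ℕ → ℕ → ℝ} (hπ : IsBalayage π) {μ : Measure Path} (h : PP π μ)
    (ht : HasTrivialTail μ) : marginals μ ∈ GG π := by
  have hp := h.1
  have hν := marg_Dpi hπ h
  refine ⟨hν, fun N a => ?_⟩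
  obtain ⟨φ, hφ, hP⟩ := extraction_forall_of_eventually'
    (P := fun K k => N ≤ k ∧ ∀ n ≥ k, ∀ m ≥ k, |VM π N a n (marginals μ) - VM π N a m (marginals μ)|
      < ((1:ℝ)/4)^K) (by
    intro K
    have hc := (VV_tendsto hπ hν N a).cauchySeq
    obtain ⟨k0, hk0⟩ := Metric.cauchySeq_iff.1 hc (((1:ℝ)/4)^K) (by positivity)
    refine ⟨max k0 N, fun k hk => ⟨le_trans (le_max_right _ _) hk, fun n hn m hm => ?_⟩⟩
    have hk' := le_trans (le_max_left _ _) hk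
    exact hk0 n (le_trans hk' hn) m (le_trans hk' hm))
  set X : ℕ → Path → ℝ := fun k S => hh π (S (φ k)) N a with hX
  have hXm : ∀ k, Measurable (X k) := fun k => meas_XX π N a (φ k)
  have hXb : ∀ k S, |X k S| ≤ 1 := fun k S => abs_hh hπ _ _ _
  have hXL : ∀ k, MemLp (X k) 2 μ := fun k =>
    MemLp.of_bound (hXm k).aestronglyMeasurable 1 (Eventually.of_forall (hXb k))
  have hae : ∀ᵐ S ∂μ, ∃ l : ℝ, Tendsto (fun k => X k S) atTop (𝓝 l) := by
    refine Lp.ae_tendsto_of_cauchy_eLpNorm (p := 2) (B := fun K => ENNReal.ofReal ((1/2)^K))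
      (fun k => (hXm k).aestronglyMeasurable) (by norm_num) ?_ ?_
    · rw [← ENNReal.ofReal_tsum_of_nonneg]
      · exact ENNReal.ofReal_ne_top
      · intro n; positivity
      · exact summable_geometric_of_lt_one (by norm_num) (by norm_num)
    · intro K n m hn hm
      rw [((hXL n).sub (hXL m)).eLpNorm_eq_integral_rpow_norm (by norm_num) (by norm_num)]
      refine (ENNReal.ofReal_lt_ofReal_iff (by positivity)).2 ?_
      have e : ∫ S, ‖(X n - X m) S‖ ^ (2:ℝ≥0∞).toReal ∂μ =
          ∫ S, (hh π (S (φ n)) N a - hh π (S (φ m)) N a)^2 ∂μ := by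
        refine integral_congr_ae (Eventually.of_forall fun S => ?_)
        simp [hX]
      rw [e]
      have hlt : ∫ S, (hh π (S (φ n)) N a - hh π (S (φ m)) N a)^2 ∂μ < (1/4)^K :=
        (int_diff_symm hπ h (hP m).1 (hP n).1 a).trans_lt
          ((hP K).2 _ (hφ.monotone hm) _ (hφ.monotone hn))
      have h0 : 0 ≤ ∫ S, (hh π (S (φ n)) N a - hh π (S (φ m)) N a)^2 ∂μ :=
        integral_nonneg fun S => sq_nonneg _
      have e2 : (1/2 : ℝ)^K = ((1/4 : ℝ)^K) ^ ((2:ℝ≥0∞).toReal⁻¹) := by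
        have : (1/4:ℝ)^K = ((1/2:ℝ)^K)^2 := by rw [← pow_mul, mul_comm, pow_mul]; norm_num
        rw [this, ENNReal.toReal_ofNat, inv_eq_one_div, ← Real.sqrt_eq_rpow, Real.sqrt_sq (by positivity)]
      rw [e2]
      exact Real.rpow_lt_rpow h0 hlt (by norm_num)
  set L : Path → ℝ := fun S => limsup (fun k => X k S) atTop with hL
  have hLt : ∀ B : Set ℝ, MeasurableSet B → MeasurableSet[pathTail] (L ⁻¹' B) := by
    intro B hB
    unfold pathTail
    rw [MeasurableSpace.measurableSet_iInf]
    intro N0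
    let F : Path → ℝ := fun T => limsup (fun k => hh π (T (φ (k + N0) - N0)) N a) atTop
    have hF : Measurable F := Measurable.limsup fun k => meas_XX π N a _
    refine ⟨F ⁻¹' B, hF hB, ?_⟩
    ext S
    have : F (fun i => S (N0 + i)) = L S := by
      simp only [F, hL]
      rw [← limsup_nat_add (fun k => X k S) N0]
      congr 1
      funext k
      have := hφ.le_apply (x := k + N0)
      simp only [hX]
      congr 2
      omega
    simp only [Set.mem_preimage, this]
  obtain ⟨c, hc⟩ : ∃ c, L =ᵐ[μ] Function.const _ c := by
    refine exists_eventuallyEq_const_of_forall_separating MeasurableSet fun B hB => ?_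
    have hm := hLt B hB
    rcases ht _ hm with h0 | h1
    · right
      exact measure_eq_zero_iff_ae_notMem.1 h0
    · left
      exact (mem_ae_iff_prob_eq_one (tail_meas hm)).2 h1
  have hlim : ∀ᵐ S ∂μ, Tendsto (fun k => X k S) atTop (𝓝 c) := by
    filter_upwards [hae, hc] with S ⟨l, hl⟩ h2
    have : L S = l := hl.limsup_eq
    rw [← this, h2] at hl
    exact hl
  have l1 : Tendsto (fun k => ∫ S, X k S ∂μ) atTop (𝓝 c) := by
    have := tendsto_integral_of_dominated_convergence (μ := μ) (F := X) (f := fun _ => c) (fun _ => 1)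
      (fun k => (hXm k).aestronglyMeasurable) (integrable_const _)
      (fun k => Eventually.of_forall (hXb k)) hlim
    simpa using this
  have l2 : Tendsto (fun k => ∫ S, (X k S)^2 ∂μ) atTop (𝓝 (c^2)) := by
    have := tendsto_integral_of_dominated_convergence (μ := μ) (F := fun k S => (X k S)^2)
      (f := fun _ => c^2) (fun _ => 1)
      (fun k => ((hXm k).pow_const 2).aestronglyMeasurable) (integrable_const _)
      (fun k => Eventually.of_forall fun S => by
        rw [Real.norm_eq_abs, abs_pow]; exact pow_le_one₀ (abs_nonneg _) (hXb k S))
      (by filter_upwards [hlim] with S hS using hS.pow 2)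
    simpa using this
  have e1 : ∀ k, ∫ S, X k S ∂μ = marginals μ N a := fun k => by
    rw [← Dpi_rep hπ hν (hP k).1 a]
    exact int1 hπ h (φ k) (fun b => hh π b N a)
  have e2 : ∀ k, ∫ S, (X k S)^2 ∂μ = VM π N a (φ k) (marginals μ) := fun k =>
    int1 hπ h (φ k) (fun b => (hh π b N a)^2)
  simp_rw [e1] at l1
  simp_rw [e2] at l2
  have c1 : marginals μ N a = c := tendsto_nhds_unique tendsto_const_nhds l1
  rw [c1]
  exact tendsto_nhds_unique ((VV_tendsto hπ hν N a).comp hφ.tendsto_atTop) l2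

lemma marg_intMap (μ : Measure Path) (N a : ℕ) : marginals μ N a =
    intMap μ (BoundedContinuousFunction.indicator _ (clopen_coord N a)) :=
  (integral_ind μ (clopen_coord N a)).symm

lemma ext_intMap {π : ℕ → ℕ → ℝ} (hπ : IsBalayage π) {μ₁ μ₂ : Measure Path}
    (h1 : PP π μ₁) (h2 : PP π μ₂) (h : intMap μ₁ = intMap μ₂) : μ₁ = μ₂ := by
  refine ext_marg hπ h1 h2 ?_
  funext N a
  rw [marg_intMap, marg_intMap, h]

lemma extreme_iff {π : ℕ → ℕ → ℝ} (hπ : IsBalayage π) {μ : Measure Path} (hμ : μ ∈ PMCpi π) :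
    intMap μ ∈ Set.extremePoints ℝ (intMap '' PMCpi π) ↔ HasTrivialTail μ := by
  have h := (PMCpi_iff hπ).1 hμ
  have hp := h.1
  constructor
  · intro he A hA
    by_contra hcon
    push Not at hcon
    obtain ⟨h0, h1⟩ := hcon
    have hmA := tail_meas hA
    have hAc : MeasurableSet[pathTail] Aᶜ := MeasurableSet.compl hA
    have h0c : μ Aᶜ ≠ 0 := fun hz => h1 ((prob_compl_eq_zero_iff hmA).1 hz)
    have p1 := PP_cond hπ h hA h0
    have p2 := PP_cond hπ h hAc h0c
    have := p1.1
    have := p2.1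
    have hst : μ A + μ Aᶜ = 1 := prob_add_prob_compl hmA
    have hdec : μ A • ProbabilityTheory.cond μ A + μ Aᶜ • ProbabilityTheory.cond μ Aᶜ = μ := by
      unfold ProbabilityTheory.cond
      rw [smul_smul, smul_smul, ENNReal.mul_inv_cancel h0 (measure_ne_top _ _),
        ENNReal.mul_inv_cancel h0c (measure_ne_top _ _), one_smul, one_smul]
      exact Measure.restrict_add_restrict_compl hmA
    have hmix := intMap_mix (μ₁ := ProbabilityTheory.cond μ A) (μ₂ := ProbabilityTheory.cond μ Aᶜ) hst
    rw [hdec] at hmix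
    have key := he.2 ⟨_, (PMCpi_iff hπ).2 p1, rfl⟩ ⟨_, (PMCpi_iff hπ).2 p2, rfl⟩
      ⟨(μ A).toReal, (μ Aᶜ).toReal, ENNReal.toReal_pos h0 (measure_ne_top _ _),
        ENNReal.toReal_pos h0c (measure_ne_top _ _), by
          rw [← ENNReal.toReal_add (measure_ne_top _ _) (measure_ne_top _ _), hst]; simp,
        hmix.symm⟩
    have heq := ext_intMap hπ p1 h key
    apply h1
    rw [← heq]
    exact ProbabilityTheory.cond_apply_self h0 (measure_ne_top _ _)
  · intro ht
    refine ⟨⟨μ, hμ, rfl⟩, ?_⟩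
    rintro _ ⟨μ₁, h1, rfl⟩ _ ⟨μ₂, h2, rfl⟩ ⟨s, t, hs, ht', hst, hc⟩
    rw [PMCpi_iff hπ] at h1 h2
    have hG := triv_GG hπ h ht
    have hm : s • marginals μ₁ + t • marginals μ₂ = marginals μ := by
      funext N a
      have := congrFun hc (BoundedContinuousFunction.indicator _ (clopen_coord N a))
      simp only [Pi.add_apply, Pi.smul_apply, ← marg_intMap] at this
      exact this
    have := GG_ext hπ hG (marg_Dpi hπ h1) (marg_Dpi hπ h2) hs ht' hst hm
    rw [ext_marg hπ h1 h this]

/-- for every balayage `π`, the set `P_MC^π(𝒮)` — embedded in the space of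
(signed) measures with the weak-* topology via integration against bounded continuous
functions (`intMap`) — is compact and convex, it is a Choquet simplex (stated on the affinely
homeomorphic metrizable copy `marginals '' PMCpi π`, where representing measures are bona
fide Borel measures), and `μ ∈ P_MC^π(𝒮)` is an extreme point if and only if `μ` has a
trivial tail σ-algebra. -/
theorem statement2 (π : ℕ → ℕ → ℝ) (hπ : IsBalayage π) :
    IsCompact (intMap '' PMCpi π) ∧
    Convex ℝ (intMap '' PMCpi π) ∧
    (∀ μ₁ ∈ PMCpi π, ∀ μ₂ ∈ PMCpi π, ∀ t : ℝ≥0∞, t ≤ 1 →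
      (t • μ₁ + (1 - t) • μ₂) ∈ PMCpi π) ∧
    IsChoquetSimplex (marginals '' PMCpi π) ∧
    ∀ μ ∈ PMCpi π,
      (intMap μ ∈ Set.extremePoints ℝ (intMap '' PMCpi π) ↔ HasTrivialTail μ) := by
  refine ⟨compact_intMap hπ, convex_intMap hπ, fun μ₁ h1 μ₂ h2 t ht => ?_, ?_,
    fun μ hμ => extreme_iff hπ hμ⟩
  · rw [PMCpi_iff hπ] at *
    exact PP_mix h1 h2 (add_tsub_cancel_of_le ht)
  · rw [marg_eq_Dpi hπ]
    exact choquet hπ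

end VMCPaper
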